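/- arXiv:1707.01369 — 2 statements merged into one kernel-verified Lean document; each statement's English description precedes it below -/
import Mathlib

section
/- For conjunctive systems with a 1-conjunctive process template U ∈ {A,B}, |G_U| + 2 is a cutoff for local deadlock detection in a U-process under non-fair executions: for all n ≥ |G_U| + 2, some run of (A,B)^(1,n) is locally deadlocked in a U-process iff some run of (A,B)^(1,|G_U|+2) is. -/
namespace GP

/-- A process template: an initial state and a guarded transition relation.
`Gd` is the type of guards. -/
structure Template (Q Sig Gd : Type) where
  init : Q
  trans : Set (Q × Sig × Gd × Q)

variable {QA QB SA SB Gd : Type}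

/-- Processes of `(A,B)^{(1,n)}`: `none` is the `A`-process, `some i` is `B_i`. -/
abbrev Proc (n : ℕ) := Option (Fin n)
/-- A global state. -/
abbrev GState (QA QB : Type) (n : ℕ) := QA × (Fin n → QB)
/-- A global input. -/
abbrev GInput (SA SB : Type) (n : ℕ) := SA × (Fin n → SB)

/-- The local state of process `p` in global state `s`. -/
def view {n : ℕ} (s : GState QA QB n) : Proc n → QA ⊕ QB
  | none => Sum.inl s.1
  | some i => Sum.inr (s.2 i)

/-- The local input of process `p` in global input `e`. -/
def inp {n : ℕ} (e : GInput SA SB n) : Proc n → SA ⊕ SB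
  | none => Sum.inl e.1
  | some i => Sum.inr (e.2 i)

/-- The set of local states of the processes other than `p`. -/
def others {n : ℕ} (s : GState QA QB n) (p : Proc n) : Set (QA ⊕ QB) :=
  {x | ∃ p', p' ≠ p ∧ view s p' = x}

/-- Disjunctive interpretation of guards: some other process is in the guard. -/
def disjSat (S : Set (QA ⊕ QB)) (g : Set (QA ⊕ QB)) : Prop := ∃ x ∈ S, x ∈ g
/-- Conjunctive interpretation of guards: every other process is in the guard. -/
def conjSat (S : Set (QA ⊕ QB)) (g : Set (QA ⊕ QB)) : Prop := ∀ x ∈ S, x ∈ g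
/-- Conjunction-of-disjunctive-guards interpretation: a guard is a finite set of
disjunctive conjuncts, each of which must be witnessed by some other process. -/
def cdSat (S : Set (QA ⊕ QB)) (g : Set (Set (QA ⊕ QB))) : Prop := ∀ D ∈ g, ∃ x ∈ S, x ∈ D

section System

variable (A : Template QA SA Gd) (B : Template QB SB Gd)
variable (sat : Set (QA ⊕ QB) → Gd → Prop)

/-- Process `p` is enabled for global state `s` and input `e`. -/
def enabled {n : ℕ} (s : GState QA QB n) (e : GInput SA SB n) : Proc n → Prop
  | none => ∃ g q', (s.1, e.1, g, q') ∈ A.trans ∧ sat (others s none) g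
  | some i => ∃ g q', (s.2 i, e.2 i, g, q') ∈ B.trans ∧ sat (others s (some i)) g

/-- One interleaving step of the system, performed by process `p`. -/
def step {n : ℕ} (s : GState QA QB n) (e : GInput SA SB n) : Proc n → GState QA QB n → Prop
  | none, s' => ∃ g q', (s.1, e.1, g, q') ∈ A.trans ∧ sat (others s none) g ∧ s' = (q', s.2)
  | some i, s' => ∃ g q', (s.2 i, e.2 i, g, q') ∈ B.trans ∧ sat (others s (some i)) g ∧
      s' = (s.1, Function.update s.2 i q')

/-- The global initial state. -/
def isInit {n : ℕ} (s : GState QA QB n) : Prop := s.1 = A.init ∧ ∀ i, s.2 i = B.init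

/-- An infinite run of `(A,B)^{(1,n)}`: at each moment `t` process `mv t` makes a step,
and the input of a process stays unchanged until that process moves. -/
structure Run (n : ℕ) where
  s : ℕ → GState QA QB n
  e : ℕ → GInput SA SB n
  mv : ℕ → Proc n
  isInit0 : isInit A B (s 0)
  steps : ∀ t, step A B sat (s t) (e t) (mv t) (s (t + 1))
  persist : ∀ t p, p ≠ mv t → inp (e (t + 1)) p = inp (e t) p

/-- The run `x` is locally deadlocked for process `p`. -/
def lockedFrom {n : ℕ} (x : Run A B sat n) (p : Proc n) : Prop :=
  ∃ t0, ∀ t ≥ t0, ¬ enabled A B sat (x.s t) (x.e t) p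

/-- The run `x` is locally deadlocked for the `B`-process `i`, which is stuck in state `q`. -/
def lockedInState {n : ℕ} (x : Run A B sat n) (i : Fin n) (q : QB) : Prop :=
  ∃ t0, ∀ t ≥ t0, ¬ enabled A B sat (x.s t) (x.e t) (some i) ∧ (x.s t).2 i = q

/-- `(A,B)^{(1,n)}` has a local deadlock. -/
def hasLocalDeadlock (n : ℕ) : Prop :=
  ∃ x : Run A B sat n, ∃ p, lockedFrom A B sat x p

/-- `(A,B)^{(1,n)}` has a global deadlock: a finite maximal path (a finite run) ending
in a configuration where no process is enabled. -/
def hasGlobalDeadlock (n : ℕ) : Prop :=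
  ∃ (m : ℕ) (s : ℕ → GState QA QB n) (e : ℕ → GInput SA SB n) (mv : ℕ → Proc n),
    isInit A B (s 0) ∧
    (∀ t < m, step A B sat (s t) (e t) (mv t) (s (t + 1))) ∧
    (∀ t < m, ∀ p, p ≠ mv t → inp (e (t + 1)) p = inp (e t) p) ∧
    ∀ p, ¬ enabled A B sat (s m) (e m) p

/-- Unconditional fairness: every process moves infinitely often. -/
def uncondFair {n : ℕ} (x : Run A B sat n) : Prop :=
  ∀ p, ∀ t, ∃ t' ≥ t, x.mv t' = p

/-- Strong fairness: every process enabled infinitely often moves infinitely often. -/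
def strongFair {n : ℕ} (x : Run A B sat n) : Prop :=
  ∀ p, (∀ t, ∃ t' ≥ t, enabled A B sat (x.s t') (x.e t') p) → (∀ t, ∃ t' ≥ t, x.mv t' = p)

/-- Initializing run: every process that moves infinitely often visits its
initial state infinitely often. -/
def initializing {n : ℕ} (x : Run A B sat n) : Prop :=
  ∀ p, (∀ t, ∃ t' ≥ t, x.mv t' = p) →
    ∀ t, ∃ t' ≥ t, view (x.s t') p = (match p with
      | none => Sum.inl A.init
      | some _ => Sum.inr B.init)

end System

/-- LTL without the next-time operator (`LTL\X`). -/
inductive LTL (P : Type) : Type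
  | atom : P → LTL P
  | tru : LTL P
  | not : LTL P → LTL P
  | and : LTL P → LTL P → LTL P
  | untl : LTL P → LTL P → LTL P

/-- Semantics of `LTL\X` over a trace `w` of valuations. -/
def LTL.holds {P : Type} (w : ℕ → P → Prop) : LTL P → ℕ → Prop
  | .atom a, t => w t a
  | .tru, _ => True
  | .not f, t => ¬ LTL.holds w f t
  | .and f g, t => LTL.holds w f t ∧ LTL.holds w g t
  | .untl f g, t => ∃ t', t ≤ t' ∧ LTL.holds w g t' ∧ ∀ u, t ≤ u → u < t' → LTL.holds w f u

/-- Atomic propositions of a `k`-indexed formula `h(A, B_{i_1}, …, B_{i_k})`: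
states/inputs of `A` and indexed states/inputs of `k` `B`-processes. -/
abbrev AtomK (QA SA QB SB : Type) (k : ℕ) := (QA ⊕ SA) ⊕ ((QB ⊕ SB) × Fin k)

section Spec

variable (A : Template QA SA Gd) (B : Template QB SB Gd)
variable (sat : Set (QA ⊕ QB) → Gd → Prop)

/-- The trace of valuations of the atomic propositions along run `x`, where the `k`
indexed `B`-processes are given by `ι`. -/
def traceK {n k : ℕ} (x : Run A B sat n) (ι : Fin k → Fin n) :
    ℕ → AtomK QA SA QB SB k → Prop := fun t a =>
  match a with
  | Sum.inl (Sum.inl qa) => (x.s t).1 = qa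
  | Sum.inl (Sum.inr sa) => (x.e t).1 = sa
  | Sum.inr (Sum.inl qb, i) => (x.s t).2 (ι i) = qb
  | Sum.inr (Sum.inr sb, i) => (x.e t).2 (ι i) = sb

/-- `(A,B)^{(1,n)} ⊨ ∀ i_1,…,i_k. E h`, relative to a fairness constraint `F` on runs. -/
def satE (k n : ℕ) (F : Run A B sat n → Prop) (h : LTL (AtomK QA SA QB SB k)) : Prop :=
  ∀ ι : Fin k ↪ Fin n, ∃ x : Run A B sat n, F x ∧ LTL.holds (traceK A B sat x ι) h 0

/-- `(A,B)^{(1,n)} ⊨ ∀ i_1,…,i_k. A h`, relative to a fairness constraint `F` on runs. -/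
def satA (k n : ℕ) (F : Run A B sat n → Prop) (h : LTL (AtomK QA SA QB SB k)) : Prop :=
  ∀ ι : Fin k ↪ Fin n, ∀ x : Run A B sat n, F x → LTL.holds (traceK A B sat x ι) h 0

/-- `c` is a cutoff for `k`-indexed `LTL\X` properties (w.r.t. fairness `F`). -/
def kCutoff (F : ∀ n, Run A B sat n → Prop) (k c : ℕ) : Prop :=
  ∀ (h : LTL (AtomK QA SA QB SB k)) (n : ℕ), c ≤ n →
    ((satE A B sat k n (F n) h ↔ satE A B sat k c (F c) h) ∧
     (satA A B sat k n (F n) h ↔ satA A B sat k c (F c) h))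

end Spec

/-- All guards appearing in transitions of a template. -/
def guardsOf {Q Sig Gd : Type} (T : Template Q Sig Gd) : Set Gd :=
  {g | ∃ q σ q', (q, σ, g, q') ∈ T.trans}

/-- The non-trivial guards of a template (different from `Q_A ∪ Q_B` and `∅`). -/
def ntGuards {Q Sig St : Type} (T : Template Q Sig (Set St)) : Set (Set St) :=
  {g | g ∈ guardsOf T ∧ g ≠ Set.univ ∧ g ≠ ∅}

/-- `|G| = |G_A ∪ G_B|`, the number of non-trivial guards of the system. -/
noncomputable def numG (A : Template QA SA (Set (QA ⊕ QB))) (B : Template QB SB (Set (QA ⊕ QB))) : ℕ :=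
  (ntGuards A ∪ ntGuards B).ncard

/-- `Enable_q`: the states of `A` and `B` that enable some transition from `q` in `B`. -/
def EnableSet (B : Template QB SB (Set (QA ⊕ QB))) (q : QB) : Set (QA ⊕ QB) :=
  {x | ∃ σ g q'', (q, σ, g, q'') ∈ B.trans ∧ x ∈ g}

section Conj

variable (A : Template QA SA (Set (QA ⊕ QB))) (B : Template QB SB (Set (QA ⊕ QB)))

/-- The standing assumption on conjunctive systems: `init_A` and `init_B`
are contained in all guards. -/
def conjInitAssumption : Prop :=
  ∀ g ∈ guardsOf A ∪ guardsOf B, Sum.inl A.init ∈ g ∧ Sum.inr B.init ∈ g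

/-- The guards of the transitions from a local state of the system. -/
def guardsFrom : QA ⊕ QB → Set (Set (QA ⊕ QB))
  | Sum.inl q => {g | ∃ σ q', (q, σ, g, q') ∈ A.trans}
  | Sum.inr q => {g | ∃ σ q', (q, σ, g, q') ∈ B.trans}

/-- `D` is a deadset of state `st` (contains at most one `A`-state, hits every guard of a
transition from `st`, and each of its members violates some guard from `st`). -/
def IsDeadset (st : QA ⊕ QB) (D : Set (QA ⊕ QB)) : Prop :=
  (∀ x ∈ D, ∀ y ∈ D, x.isLeft → y.isLeft → x = y) ∧
  (∀ g ∈ guardsFrom A B st, ∃ x ∈ D, x ∉ g) ∧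
  (∀ x ∈ D, ∃ g ∈ guardsFrom A B st, x ∉ g)

/-- A state is free if it has no deadset. -/
def IsFreeState (st : QA ⊕ QB) : Prop := ¬ ∃ D, IsDeadset A B st D

/-- A state is non-blocking if it appears in no deadset of any state. -/
def IsNonBlocking (x : QA ⊕ QB) : Prop := ∀ st D, IsDeadset A B st D → x ∉ D

/-- A state is not self-blocking if it appears in no deadset of itself. -/
def IsNotSelfBlocking (st : QA ⊕ QB) : Prop := ∀ D, IsDeadset A B st D → st ∉ D

/-- A locally deadlocked run that is alternation-free: eventually one single deadset of the
deadlocked state remains covered forever (no infinite alternation between deadsets). -/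
def altFreeLockedRun {n : ℕ} (x : Run A B conjSat n) (p : Proc n) : Prop :=
  ∃ t0 D, (∀ t ≥ t0, ¬ enabled A B conjSat (x.s t) (x.e t) p) ∧
    IsDeadset A B (view (x.s t0) p) D ∧ ∀ t ≥ t0, D ⊆ others (x.s t) p

end Conj

section UProps

variable {QU SU : Type}
variable (U : Template QU SU (Set (QA ⊕ QB))) (emb : QU → QA ⊕ QB)

/-- Guards of transitions from state `q` of template `U`. -/
def uGFrom (q : QU) : Set (Set (QA ⊕ QB)) := {g | ∃ σ q', (q, σ, g, q') ∈ U.trans}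

/-- A deadset of state `q` of template `U`. -/
def uDeadset (q : QU) (D : Set (QA ⊕ QB)) : Prop :=
  (∀ x ∈ D, ∀ y ∈ D, x.isLeft → y.isLeft → x = y) ∧
  (∀ g ∈ uGFrom U q, ∃ x ∈ D, x ∉ g) ∧
  (∀ x ∈ D, ∃ g ∈ uGFrom U q, x ∉ g)

/-- A state of `U` is free if it has no deadset. -/
def uFreeState (q : QU) : Prop := ¬ ∃ D, uDeadset U q D

/-- A `1`-conjunctive guard excludes exactly one state. -/
def OneConjGuard (g : Set (QA ⊕ QB)) : Prop := ∃ x : QA ⊕ QB, g = {x}ᶜ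

/-- A state is `1`-conjunctive if all its non-trivial guards are `1`-conjunctive. -/
def uOneConjState (q : QU) : Prop :=
  ∀ g ∈ uGFrom U q, g ≠ Set.univ → g ≠ ∅ → OneConjGuard g

/-- A template is `1`-conjunctive if all its states are. -/
def uOneConj : Prop := ∀ q : QU, uOneConjState U q

/-- Effectively `1`-conjunctive: every state is `1`-conjunctive or free. -/
def uEff1Conj : Prop := ∀ q : QU, uOneConjState U q ∨ uFreeState U q

/-- Transitions of `U`, as quadruples. -/
abbrev Edge (QU SU St : Type) := QU × SU × Set St × QU

def esrc {St : Type} (e : Edge QU SU St) : QU := e.1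
def etgt {St : Type} (e : Edge QU SU St) : QU := e.2.2.2
def egrd {St : Type} (e : Edge QU SU St) : Set St := e.2.2.1

/-- A connected sequence of transitions of `U`. -/
def uEPath (l : List (Edge QU SU (QA ⊕ QB))) : Prop :=
  (∀ e ∈ l, e ∈ U.trans) ∧ l.Chain' (fun e e' => etgt e = esrc e')

/-- A cycle through `q`: a nonempty connected transition sequence from `q` back to `q`
visiting pairwise distinct states. -/
def uIsCycle (q : QU) (l : List (Edge QU SU (QA ⊕ QB))) : Prop :=
  l ≠ [] ∧ uEPath U l ∧
  (∃ e0 ∈ l.head?, esrc e0 = q) ∧ (∃ en ∈ l.getLast?, etgt en = q) ∧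
  (l.map esrc).Nodup

/-- The states on a cycle (or transition sequence). -/
def cycStates {St : Type} (l : List (Edge QU SU St)) : Set QU := {s | ∃ e ∈ l, esrc e = s}

/-- The guards on a cycle (or transition sequence). -/
def cycGuards {St : Type} (l : List (Edge QU SU St)) : Set (Set St) := {g | ∃ e ∈ l, egrd e = g}

/-- A lasso: a connected transition sequence starting at the initial state and
ending with a cycle. -/
def uIsLasso (l : List (Edge QU SU (QA ⊕ QB))) : Prop :=
  uEPath U l ∧ (∃ e0 ∈ l.head?, esrc e0 = U.init) ∧
  ∃ l1 l2 q, l = l1 ++ l2 ∧ uIsCycle U q l2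

/-- `D` disables all `n`-conjunctive guards with `n > 1` of transitions from `q`. -/
def uDisablesBig (q : QU) (D : Set (QA ⊕ QB)) : Prop :=
  ∀ g ∈ uGFrom U q, g ≠ Set.univ → 2 ≤ (gᶜ).ncard → ∃ x ∈ D, x ∉ g

/-- Freely traversable template: for every non-free state `q` and every set of states
disabling the `n`-conjunctive guards (`n > 1`) from `q`, there is a lasso whose guards
avoid `¬q`, avoid all `¬q_i`, and avoid all `1`-conjunctive guards from `q`. -/
def uFreelyTraversable : Prop :=
  ∀ q : QU, ¬ uFreeState U q → ∀ D, uDisablesBig U q D →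
    ∃ l, uIsLasso U l ∧ ∀ g ∈ cycGuards l,
      emb q ∈ g ∧ (∀ x ∈ D, x ∈ g) ∧ ∀ x : QA ⊕ QB, ({x}ᶜ ∈ uGFrom U q) → x ∈ g

/-- `x` has a cycle through it that is disjoint from all cycles through `q` and
whose guards never exclude `q`. -/
def uBadCycleFor (q : QU) (x : QA ⊕ QB) : Prop :=
  ∃ qx : QU, emb qx = x ∧ ∃ c, uIsCycle U qx c ∧
    (∀ s ∈ cycStates c, ¬ ∃ cq, uIsCycle U q cq ∧ s ∈ cycStates cq) ∧
    (∀ g ∈ cycGuards c, emb q ∈ g)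

/-- Alternation-free template. -/
def uAltFree : Prop :=
  (∀ q : QU, ¬ uFreeState U q → ∀ D, uDisablesBig U q D →
    ∀ x ∈ D, ∀ y ∈ D, uBadCycleFor U emb q x → uBadCycleFor U emb q y → x = y) ∨
  (∀ q : QU, ¬ uFreeState U q → ∀ g ∈ uGFrom U q, 2 ≤ (gᶜ).ncard →
    ∃ x ∈ gᶜ, {x}ᶜ ∈ uGFrom U q)

end UProps


section LocalDeadlock

variable (A : Template QA SA (Set (QA ⊕ QB))) (B : Template QB SB (Set (QA ⊕ QB)))

/-- The transitions of both templates, as a relation on the disjoint union of their states. -/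
def localTrans : QA ⊕ QB → SA ⊕ SB → Set (QA ⊕ QB) → QA ⊕ QB → Prop
  | Sum.inl q, Sum.inl a, g, Sum.inl q' => (q, a, g, q') ∈ A.trans
  | Sum.inr q, Sum.inr b, g, Sum.inr q' => (q, b, g, q') ∈ B.trans
  | _, _, _, _ => False

variable {A B} {n : ℕ}

theorem GState.ext_view {s s' : GState QA QB n} (h : ∀ p, view s p = view s' p) : s = s' :=
  Prod.ext (Sum.inl_injective (h none)) (funext fun i => Sum.inr_injective (h (some i)))

theorem enabled_iff_localTrans {s : GState QA QB n} {e : GInput SA SB n} {p : Proc n} :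
    enabled A B conjSat s e p ↔
      ∃ g v, localTrans A B (view s p) (inp e p) g v ∧ conjSat (others s p) g := by
  cases p <;> simp [enabled, view, inp, localTrans]

theorem step_iff_localTrans {s s' : GState QA QB n} {e : GInput SA SB n} {p : Proc n} :
    step A B conjSat s e p s' ↔
      ∃ g, localTrans A B (view s p) (inp e p) g (view s' p) ∧ conjSat (others s p) g ∧
        ∀ p', p' ≠ p → view s' p' = view s p' := by
  cases p with
  | none =>
    constructor
    · rintro ⟨g, q', ht, hg, rfl⟩
      refine ⟨g, ht, hg, ?_⟩
      rintro (_ | i) h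
      · exact absurd rfl h
      · rfl
    · rintro ⟨g, ht, hg, h⟩
      refine ⟨g, s'.1, ht, hg, GState.ext_view ?_⟩
      rintro (_ | i)
      · rfl
      · exact h (some i) (by simp)
  | some i =>
    constructor
    · rintro ⟨g, q', ht, hg, rfl⟩
      refine ⟨g, by simpa [view, inp, localTrans] using ht, hg, ?_⟩
      rintro (_ | j) h
      · rfl
      · have : j ≠ i := fun hji => h (congrArg some hji)
        simp [view, this]
    · rintro ⟨g, ht, hg, h⟩
      refine ⟨g, s'.2 i, ht, hg, GState.ext_view ?_⟩
      rintro (_ | j)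
      · exact h none (by simp)
      · by_cases hji : j = i
        · subst hji
          simp [view]
        · simpa [view, hji] using h (some j) (by simpa using hji)

theorem enabled_of_step {s s' : GState QA QB n} {e : GInput SA SB n} {p : Proc n}
    (h : step A B conjSat s e p s') : enabled A B conjSat s e p := by
  obtain ⟨g, ht, hg, -⟩ := step_iff_localTrans.1 h
  exact enabled_iff_localTrans.2 ⟨g, _, ht, hg⟩

theorem init_mem_of_localTrans (hinit : conjInitAssumption A B) {v v' : QA ⊕ QB}
    {σ : SA ⊕ SB} {g : Set (QA ⊕ QB)} (h : localTrans A B v σ g v') :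
    Sum.inl A.init ∈ g ∧ Sum.inr B.init ∈ g := by
  apply hinit
  rcases v with q | q <;> rcases σ with a | a <;> rcases v' with q' | q' <;>
    simp only [localTrans] at h
  · exact Or.inl ⟨q, a, q', h⟩
  · exact Or.inr ⟨q, a, q', h⟩

theorem view_init_mem (hinit : conjInitAssumption A B) {s : GState QA QB n}
    (hs : isInit A B s) {v v' : QA ⊕ QB} {σ : SA ⊕ SB} {g : Set (QA ⊕ QB)}
    (h : localTrans A B v σ g v') (p : Proc n) : view s p ∈ g := by
  obtain ⟨hA, hB⟩ := init_mem_of_localTrans hinit h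
  cases p with
  | none => simpa [view, hs.1] using hA
  | some i => simpa [view, hs.2 i] using hB

/-- Deleting the idle moments of a stuttering execution yields a run. -/
theorem exists_run_of_stuttering (s : ℕ → GState QA QB n) (e : ℕ → GInput SA SB n)
    (mv : ℕ → Proc n) (act : ℕ → Prop) (h0 : isInit A B (s 0))
    (hact : ∀ t, act t → step A B conjSat (s t) (e t) (mv t) (s (t + 1)) ∧
      ∀ p, p ≠ mv t → inp (e (t + 1)) p = inp (e t) p)
    (hidle : ∀ t, ¬ act t → s (t + 1) = s t ∧ e (t + 1) = e t)
    (hinf : ∀ t, ∃ t' ≥ t, act t') :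
    ∃ (x : Run A B conjSat n) (f : ℕ → ℕ), StrictMono f ∧
      ∀ k, x.s k = s (f k) ∧ x.e k = e (f k) ∧ x.mv k = mv (f k) ∧ act (f k) := by
  classical
  have hfin : (Set.ofPred act).Infinite := by
    refine Set.infinite_of_not_bddAbove ?_
    rintro ⟨b, hb⟩
    obtain ⟨t, ht, hat⟩ := hinf (b + 1)
    have : t ≤ b := hb hat
    omega
  have hmono : StrictMono (Nat.nth act) := Nat.nth_strictMono hfin
  have hmem : ∀ k, act (Nat.nth act k) := Nat.nth_mem_of_infinite hfin
  have hconst : ∀ a b, a ≤ b → (∀ t, a ≤ t → t < b → ¬ act t) → s b = s a ∧ e b = e a := by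
    intro a b hab
    induction b, hab using Nat.le_induction with
    | base => exact fun _ => ⟨rfl, rfl⟩
    | succ b hab ih =>
      intro h
      obtain ⟨h1, h2⟩ := ih fun t hat htb => h t hat (by omega)
      obtain ⟨h3, h4⟩ := hidle b (h b hab (by omega))
      exact ⟨h3.trans h1, h4.trans h2⟩
  have hstart : s (Nat.nth act 0) = s 0 := by
    refine (hconst 0 _ (Nat.zero_le _) fun t _ ht hat => ?_).1
    have := hmono.monotone (Nat.zero_le (Nat.count act t))
    rw [Nat.nth_count hat] at this
    omega
  have hnext : ∀ k, s (Nat.nth act (k + 1)) = s (Nat.nth act k + 1) ∧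
      e (Nat.nth act (k + 1)) = e (Nat.nth act k + 1) := by
    intro k
    refine hconst _ _ (hmono (Nat.lt_succ_self k)) fun t h1 h2 hat => ?_
    have := Nat.le_nth_of_lt_nth_succ h2 hat
    omega
  refine ⟨⟨fun k => s (Nat.nth act k), fun k => e (Nat.nth act k),
    fun k => mv (Nat.nth act k), ?_, ?_, ?_⟩, Nat.nth act, hmono,
    fun k => ⟨rfl, rfl, rfl, hmem k⟩⟩
  · rw [hstart]
    exact h0
  · intro k
    rw [(hnext k).1]
    exact (hact _ (hmem k)).1
  · intro k
    rw [(hnext k).2]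
    exact (hact _ (hmem k)).2

theorem Run.view_succ (x : Run A B conjSat n) {t : ℕ} {p : Proc n} (h : p ≠ x.mv t) :
    view (x.s (t + 1)) p = view (x.s t) p := by
  obtain ⟨g, -, -, hp⟩ := step_iff_localTrans.1 (x.steps t)
  exact hp p h

/-- Slowing down the processes of a run by local clocks `τ`, where `live p t` says that `p`
may still follow the run at moment `t`. -/
theorem exists_run_of_clocks (x : Run A B conjSat n) (live : Proc n → ℕ → Prop)
    (τ : Proc n → ℕ → ℕ) (hτ0 : ∀ p, τ p 0 = 0)
    (hlive : ∀ p t, live p t → τ p t = t ∧ τ p (t + 1) = t + 1)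
    (hdead : ∀ p t, ¬ live p t → τ p (t + 1) = τ p t)
    (hguard : ∀ t, live (x.mv t) t → ∃ g,
      localTrans A B (view (x.s t) (x.mv t)) (inp (x.e t) (x.mv t)) g
        (view (x.s (t + 1)) (x.mv t)) ∧
      ∀ p, p ≠ x.mv t → view (x.s (τ p t)) p ∈ g)
    (hinf : ∀ t, ∃ t' ≥ t, live (x.mv t') t') :
    ∃ (y : Run A B conjSat n) (f : ℕ → ℕ), StrictMono f ∧
      ∀ k, (∀ p, view (y.s k) p = view (x.s (τ p (f k))) p ∧
        inp (y.e k) p = inp (x.e (τ p (f k))) p) ∧ live (y.mv k) (f k) := by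
  let s' : ℕ → GState QA QB n := fun t =>
    ((x.s (τ none t)).1, fun i => (x.s (τ (some i) t)).2 i)
  let e' : ℕ → GInput SA SB n := fun t =>
    ((x.e (τ none t)).1, fun i => (x.e (τ (some i) t)).2 i)
  have hs : ∀ t p, view (s' t) p = view (x.s (τ p t)) p := by
    rintro t (_ | i) <;> rfl
  have he : ∀ t p, inp (e' t) p = inp (x.e (τ p t)) p := by
    rintro t (_ | i) <;> rfl
  have hstill : ∀ t p, p ≠ x.mv t ∨ ¬ live p t →
      view (s' (t + 1)) p = view (s' t) p ∧ inp (e' (t + 1)) p = inp (e' t) p := by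
    intro t p h
    rw [hs, hs, he, he]
    by_cases hp : live p t
    · obtain ⟨h1, h2⟩ := hlive p t hp
      have hne : p ≠ x.mv t := h.resolve_right (not_not.2 hp)
      rw [h1, h2]
      exact ⟨x.view_succ hne, x.persist t p hne⟩
    · rw [hdead p t hp]
      exact ⟨rfl, rfl⟩
  obtain ⟨y, f, hf, hy⟩ := exists_run_of_stuttering (A := A) (B := B) s' e' x.mv
    (fun t => live (x.mv t) t)
    ⟨by simpa [s', hτ0] using x.isInit0.1, fun i => by simpa [s', hτ0] using x.isInit0.2 i⟩
    (by
      intro t ht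
      obtain ⟨h1, h2⟩ := hlive _ t ht
      obtain ⟨g, hg, hsat⟩ := hguard t ht
      refine ⟨step_iff_localTrans.2 ⟨g, ?_, ?_, fun p hp => (hstill t p (Or.inl hp)).1⟩,
        fun p hp => (hstill t p (Or.inl hp)).2⟩
      · rw [hs, hs, he, h1, h2]
        exact hg
      · rintro _ ⟨p, hp, rfl⟩
        rw [hs]
        exact hsat p hp)
    (by
      intro t ht
      have key : ∀ p, p ≠ x.mv t ∨ ¬ live p t := by
        intro p
        by_cases hp : p = x.mv t
        · exact Or.inr (hp ▸ ht)
        · exact Or.inl hp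
      refine ⟨GState.ext_view fun p => (hstill t p (key p)).1,
        GState.ext_view (QA := SA) (QB := SB) fun p => ?_⟩
      have := (hstill t p (key p)).2
      cases p <;> exact this)
    hinf
  refine ⟨y, f, hf, fun k => ?_⟩
  obtain ⟨h1, h2, h3, h4⟩ := hy k
  refine ⟨fun p => ?_, ?_⟩
  · rw [h1, h2, hs, he]
    exact ⟨rfl, rfl⟩
  · rw [h3]
    exact h4

theorem Run.const_of_not_move (x : Run A B conjSat n) {T : ℕ} {p : Proc n}
    (h : ∀ t ≥ T, x.mv t ≠ p) {t : ℕ} (ht : T ≤ t) :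
    view (x.s t) p = view (x.s T) p ∧ inp (x.e t) p = inp (x.e T) p := by
  induction t, ht using Nat.le_induction with
  | base => exact ⟨rfl, rfl⟩
  | succ t ht ih =>
    exact ⟨(x.view_succ (h t ht).symm).trans ih.1, (x.persist t p (h t ht).symm).trans ih.2⟩

/-- If from moment `T` on a set `D` of states blocks `p`, `D` is covered at `T` by the processes
`c d`, and the process `r` moves infinitely often without depending on the others, then few
`B`-processes suffice to block `p`. -/
theorem exists_lockedFrom_few_movers (hinit : conjInitAssumption A B)
    (x : Run A B conjSat n) (T : ℕ) (p r : Proc n) (D : Set (QA ⊕ QB)) (hD : D.Finite)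
    (c : QA ⊕ QB → Proc n)
    (hp : ∀ t ≥ T, x.mv t ≠ p)
    (hc : ∀ d ∈ D, c d ≠ p ∧ view (x.s T) (c d) = d)
    (hr : ∀ t, ∃ t' ≥ t, x.mv t' = r)
    (hstay : ∀ t ≥ T, ∀ d ∈ D, c d = none ∨ c d = r → view (x.s t) (c d) = d)
    (hguard : ∀ t ≥ T, ∃ g,
      localTrans A B (view (x.s t) (x.mv t)) (inp (x.e t) (x.mv t)) g
        (view (x.s (t + 1)) (x.mv t)) ∧
      conjSat (others (x.s t) (x.mv t)) g ∧ ∀ d ∈ D, c d ≠ x.mv t → d ∈ g)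
    (hblock : ∀ g v, localTrans A B (view (x.s T) p) (inp (x.e T) p) g v → ∃ d ∈ D, d ∉ g) :
    ∃ (y : Run A B conjSat n) (K : Finset (Fin n)), lockedFrom A B conjSat y p ∧
      K.card ≤ D.ncard + 2 ∧ (∀ i, p = some i → i ∈ K) ∧
      ∀ i, i ∉ K → ∀ t, y.mv t ≠ some i := by
  classical
  let L : Set (Proc n) := {m | m = none ∨ m = r}
  let F : Set (Proc n) := {m | m = p ∨ m ∈ c '' D}
  let live : Proc n → ℕ → Prop := fun m t => m ∈ L ∨ (m ∈ F ∧ t < T)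
  let τ : Proc n → ℕ → ℕ := fun m t => if m ∈ L then t else if m ∈ F then min t T else 0
  have hτL : ∀ m t, m ∈ L → τ m t = t := fun m t h => if_pos h
  have hτF : ∀ m t, m ∉ L → m ∈ F → τ m t = min t T := fun m t h h' => by
    simp only [τ, if_neg h, if_pos h']
  have hτ0 : ∀ m t, m ∉ L → m ∉ F → τ m t = 0 := fun m t h h' => by
    simp only [τ, if_neg h, if_neg h']
  obtain ⟨y, f, hf, hy⟩ := exists_run_of_clocks x live τ
    (by
      intro m
      simp only [τ]
      split_ifs <;> simp)
    (by
      rintro m t (h | ⟨h, ht⟩)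
      · exact ⟨hτL _ _ h, hτL _ _ h⟩
      · by_cases hm : m ∈ L
        · exact ⟨hτL _ _ hm, hτL _ _ hm⟩
        · rw [hτF _ _ hm h, hτF _ _ hm h]
          omega)
    (by
      intro m t h
      by_cases hm : m ∈ L
      · exact absurd (Or.inl hm) h
      · by_cases hm' : m ∈ F
        · have : ¬ t < T := fun ht => h (Or.inr ⟨hm', ht⟩)
          rw [hτF _ _ hm hm', hτF _ _ hm hm']
          omega
        · rw [hτ0 _ _ hm hm', hτ0 _ _ hm hm'])
    (by
      intro t _
      rcases lt_or_ge t T with htT | htT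
      · obtain ⟨g, hg, hsat, -⟩ := step_iff_localTrans.1 (x.steps t)
        refine ⟨g, hg, fun m hm => ?_⟩
        by_cases h1 : m ∈ L
        · rw [hτL _ _ h1]
          exact hsat _ ⟨m, hm, rfl⟩
        · by_cases h2 : m ∈ F
          · rw [hτF _ _ h1 h2, min_eq_left htT.le]
            exact hsat _ ⟨m, hm, rfl⟩
          · rw [hτ0 _ _ h1 h2]
            exact view_init_mem hinit x.isInit0 hg m
      · obtain ⟨g, hg, hsat, hDg⟩ := hguard t htT
        refine ⟨g, hg, fun m hm => ?_⟩
        by_cases h1 : m ∈ L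
        · rw [hτL _ _ h1]
          exact hsat _ ⟨m, hm, rfl⟩
        · by_cases h2 : m ∈ F
          · rw [hτF _ _ h1 h2, min_eq_right htT]
            rcases h2 with rfl | ⟨d, hd, rfl⟩
            · rw [← (x.const_of_not_move hp htT).1]
              exact hsat _ ⟨m, hm, rfl⟩
            · rw [(hc d hd).2]
              exact hDg d hd hm
          · rw [hτ0 _ _ h1 h2]
            exact view_init_mem hinit x.isInit0 hg m)
    (by
      intro t
      obtain ⟨t', ht', h⟩ := hr t
      exact ⟨t', ht', Or.inl (Or.inr h)⟩)
  let K : Finset (Fin n) := Finset.univ.filter fun i => some i = r ∨ some i ∈ F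
  refine ⟨y, K, ⟨T, fun k hk hen => ?_⟩, ?_, ?_, ?_⟩
  · have hfk : T ≤ f k := hk.trans hf.le_apply
    obtain ⟨g, v, htr, hsat⟩ := enabled_iff_localTrans.1 hen
    have hpT : T ≤ τ p (f k) := by
      by_cases h1 : p ∈ L
      · rw [hτL _ _ h1]
        exact hfk
      · rw [hτF _ _ h1 (Or.inl rfl)]
        omega
    obtain ⟨hpv, hpi⟩ := x.const_of_not_move hp hpT
    rw [((hy k).1 p).1, ((hy k).1 p).2, hpv, hpi] at htr
    obtain ⟨d, hd, hdg⟩ := hblock g v htr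
    refine hdg (hsat d ⟨c d, (hc d hd).1, ?_⟩)
    rw [((hy k).1 _).1]
    by_cases h1 : c d ∈ L
    · rw [hτL _ _ h1]
      exact hstay _ hfk d hd h1
    · rw [hτF _ _ h1 (Or.inr ⟨d, hd, rfl⟩), min_eq_right hfk]
      exact (hc d hd).2
  · have hsub : K.map Function.Embedding.some ⊆ insert r (insert p (hD.toFinset.image c)) := by
      intro m hm
      obtain ⟨i, hi, rfl⟩ := Finset.mem_map.1 hm
      have hi' : some i = r ∨ some i ∈ F := (Finset.mem_filter.1 hi).2
      rcases hi' with h | h | ⟨d, hd, h⟩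
      · exact Finset.mem_insert.2 (Or.inl h)
      · exact Finset.mem_insert_of_mem (Finset.mem_insert.2 (Or.inl h))
      · exact Finset.mem_insert_of_mem (Finset.mem_insert_of_mem
          (Finset.mem_image.2 ⟨d, hD.mem_toFinset.2 hd, h⟩))
    have h1 := Finset.card_le_card hsub
    rw [Finset.card_map] at h1
    have h2 := Finset.card_insert_le r (insert p (hD.toFinset.image c))
    have h3 := Finset.card_insert_le p (hD.toFinset.image c)
    have h4 : (hD.toFinset.image c).card ≤ hD.toFinset.card := Finset.card_image_le
    rw [Set.ncard_eq_toFinset_card D hD]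
    omega
  · intro i hi
    exact Finset.mem_filter.2 ⟨Finset.mem_univ _, Or.inr (Or.inl hi.symm)⟩
  · intro i hi t hmv
    refine hi (Finset.mem_filter.2 ⟨Finset.mem_univ _, ?_⟩)
    have := (hy t).2
    rw [hmv] at this
    rcases this with (h | h) | ⟨h, -⟩
    · exact absurd h (by simp)
    · exact Or.inl h
    · exact Or.inr h

/-- A self-loop taken by process `m` at moment `T` can be repeated forever. -/
theorem exists_run_repeating_self_loop (x : Run A B conjSat n) (T : ℕ)
    (h : view (x.s (T + 1)) (x.mv T) = view (x.s T) (x.mv T)) :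
    ∃ y : Run A B conjSat n, (∀ t ≥ T, y.s t = x.s T ∧ y.e t = x.e T ∧ y.mv t = x.mv T) := by
  have hs : x.s (T + 1) = x.s T := by
    refine GState.ext_view fun p => ?_
    by_cases hp : p = x.mv T
    · rw [hp, h]
    · exact x.view_succ hp
  refine ⟨⟨fun t => x.s (min t T), fun t => x.e (min t T), fun t => x.mv (min t T),
    by simpa using x.isInit0, fun t => ?_, fun t p hp => ?_⟩, fun t ht => ?_⟩
  · rcases lt_or_ge t T with ht | ht
    · rw [min_eq_left ht.le, min_eq_left (Nat.succ_le_of_lt ht)]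
      exact x.steps t
    · rw [min_eq_right ht, min_eq_right (by omega : T ≤ t + 1)]
      have := x.steps T
      rwa [hs] at this
  · rcases lt_or_ge t T with ht | ht
    · rw [min_eq_left ht.le] at hp ⊢
      rw [min_eq_left (Nat.succ_le_of_lt ht)]
      exact x.persist t p hp
    · rw [min_eq_right ht, min_eq_right (by omega : T ≤ t + 1)]
  · simp only [min_eq_right ht, and_self]

theorem Run.exists_frequent_mover (x : Run A B conjSat n) :
    ∃ r, ∀ t, ∃ t' ≥ t, x.mv t' = r := by
  obtain ⟨r, hr⟩ := Finite.exists_infinite_fiber x.mv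
  refine ⟨r, fun t => ?_⟩
  obtain ⟨t', ht', h⟩ := (Set.infinite_coe_iff.1 hr).exists_gt t
  exact ⟨t', h.le, ht'⟩

/-- In a run that is locally deadlocked for `p`, whose nontrivial guards are `1`-conjunctive,
all but few `B`-processes may be assumed never to move. -/
theorem exists_lockedFrom_few_movers_of_oneConj [Finite QA] [Finite QB]
    (hinit : conjInitAssumption A B) (k : ℕ)
    (x : Run A B conjSat n) (p : Proc n) (hx : lockedFrom A B conjSat x p)
    (hone : ∀ t g v, localTrans A B (view (x.s t) p) (inp (x.e t) p) g v →
      g ≠ Set.univ → OneConjGuard g)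
    (hcard : ∀ t, {d | ∃ v, localTrans A B (view (x.s t) p) (inp (x.e t) p) {d}ᶜ v}.ncard ≤ k) :
    ∃ (y : Run A B conjSat n) (K : Finset (Fin n)), lockedFrom A B conjSat y p ∧
      K.card ≤ k + 2 ∧ (∀ i, p = some i → i ∈ K) ∧
      ∀ i, i ∉ K → ∀ t, y.mv t ≠ some i := by
  classical
  obtain ⟨t0, hlock⟩ := hx
  have hmv : ∀ t ≥ t0, x.mv t ≠ p := by
    intro t ht h
    exact hlock t ht (h ▸ enabled_of_step (x.steps t))
  have hcst : ∀ t ≥ t0, view (x.s t) p = view (x.s t0) p ∧ inp (x.e t) p = inp (x.e t0) p :=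
    fun t ht => x.const_of_not_move hmv ht
  set D : Set (QA ⊕ QB) :=
    {d | ∃ v, localTrans A B (view (x.s t0) p) (inp (x.e t0) p) {d}ᶜ v} with hDdef
  have hcov : ∀ t ≥ t0, ∀ d ∈ D, ∃ m, m ≠ p ∧ view (x.s t) m = d := by
    rintro t ht d ⟨v, hv⟩
    by_contra! hcon
    refine hlock t ht (enabled_iff_localTrans.2 ⟨{d}ᶜ, v, ?_, ?_⟩)
    · rw [(hcst t ht).1, (hcst t ht).2]
      exact hv
    · rintro _ ⟨m, hm, rfl⟩
      exact hcon m hm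
  have hblock : ∀ t ≥ t0, ∀ g v,
      localTrans A B (view (x.s t) p) (inp (x.e t) p) g v → ∃ d ∈ D, d ∉ g := by
    intro t ht g v hv
    have hne : g ≠ Set.univ := by
      rintro rfl
      exact hlock t ht (enabled_iff_localTrans.2 ⟨_, v, hv, fun _ _ => Set.mem_univ _⟩)
    obtain ⟨d, rfl⟩ := hone t g v hv hne
    rw [(hcst t ht).1, (hcst t ht).2] at hv
    exact ⟨d, ⟨v, hv⟩, by simp⟩
  suffices hsuff : ∃ (y : Run A B conjSat n) (K : Finset (Fin n)), lockedFrom A B conjSat y p ∧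
      K.card ≤ D.ncard + 2 ∧ (∀ i, p = some i → i ∈ K) ∧
      ∀ i, i ∉ K → ∀ t, y.mv t ≠ some i by
    obtain ⟨y, K, h1, h2, h3⟩ := hsuff
    exact ⟨y, K, h1, h2.trans (Nat.add_le_add_right (hcard t0) 2), h3⟩
  by_cases hloop : ∃ t ≥ t0, view (x.s t) (x.mv t) ∈ D ∧
      view (x.s (t + 1)) (x.mv t) = view (x.s t) (x.mv t)
  · obtain ⟨T, hT, hTD, hTloop⟩ := hloop
    obtain ⟨y, hy⟩ := exists_run_repeating_self_loop x T hTloop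
    have hex : ∀ d, ∃ m, d ∈ D → m ≠ p ∧ view (x.s T) m = d ∧
        (d = view (x.s T) (x.mv T) → m = x.mv T) := by
      intro d
      by_cases hd : d ∈ D
      · by_cases hdm : d = view (x.s T) (x.mv T)
        · exact ⟨x.mv T, fun _ => ⟨hmv T hT, hdm.symm, fun _ => rfl⟩⟩
        · obtain ⟨m, h1, h2⟩ := hcov T hT d hd
          exact ⟨m, fun _ => ⟨h1, h2, fun h => absurd h hdm⟩⟩
      · exact ⟨p, fun h => absurd h hd⟩
    choose c hc using hex
    have hyT := hy T le_rfl
    refine exists_lockedFrom_few_movers hinit y T p (x.mv T) D D.toFinite c ?_ ?_ ?_ ?_ ?_ ?_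
    · intro t ht
      rw [(hy t ht).2.2]
      exact hmv T hT
    · intro d hd
      rw [hyT.1]
      exact ⟨(hc d hd).1, (hc d hd).2.1⟩
    · exact fun t => ⟨max t T, le_max_left _ _, (hy _ (le_max_right _ _)).2.2⟩
    · intro t ht d hd _
      rw [(hy t ht).1]
      exact (hc d hd).2.1
    · intro t ht
      obtain ⟨g, hg, hsat, -⟩ := step_iff_localTrans.1 (x.steps T)
      rw [(hy t ht).1, (hy t ht).2.1, (hy t ht).2.2, (hy (t + 1) (by omega)).1]
      rw [hTloop] at hg
      refine ⟨g, hg, hsat, fun d hd hne => ?_⟩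
      exact hsat d ⟨c d, hne, (hc d hd).2.1⟩
    · rw [hyT.1, hyT.2.1]
      exact hblock T hT
  · push Not at hloop
    obtain ⟨r, hr⟩ := x.exists_frequent_mover
    obtain ⟨t1, ht1, hmr⟩ := hr t0
    have hex : ∀ d, ∃ m, d ∈ D → m ≠ p ∧ m ≠ r ∧ view (x.s (t1 + 1)) m = d := by
      intro d
      by_cases hd : d ∈ D
      · by_cases hdr : view (x.s t1) r = d
        · obtain ⟨m, h1, h2⟩ := hcov (t1 + 1) (by omega) d hd
          refine ⟨m, fun _ => ⟨h1, ?_, h2⟩⟩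
          rintro rfl
          refine hloop t1 ht1 ?_ ?_
          · rw [hmr, hdr]
            exact hd
          · rw [hmr, h2, hdr]
        · obtain ⟨m, h1, h2⟩ := hcov t1 ht1 d hd
          have hmne : m ≠ r := by
            rintro rfl
            exact hdr h2
          exact ⟨m, fun _ => ⟨h1, hmne, (x.view_succ (hmr ▸ hmne)).trans h2⟩⟩
      · exact ⟨p, fun h => absurd h hd⟩
    choose c hc using hex
    refine exists_lockedFrom_few_movers hinit x (t1 + 1) p r D D.toFinite c
      (fun t ht => hmv t (by omega)) (fun d hd => ⟨(hc d hd).1, (hc d hd).2.2⟩) hr ?_ ?_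
      (hblock _ (by omega))
    · rintro t ht d hd (h | h)
      · obtain ⟨m, h1, h2⟩ := hcov t (by omega) d hd
        have h3 := (hc d hd).2.2
        rw [h] at h3 ⊢
        cases m with
        | none => exact h2
        | some i =>
          rw [← h2] at h3
          simp [view] at h3
      · exact absurd h (hc d hd).2.1
    · intro t ht
      obtain ⟨g, hg, hsat, -⟩ := step_iff_localTrans.1 (x.steps t)
      refine ⟨g, hg, hsat, fun d hd _ => ?_⟩
      obtain ⟨m, h1, h2⟩ := hcov t (by omega) d hd
      by_cases hm : m = x.mv t
      · subst hm
        obtain ⟨m', h3, h4⟩ := hcov (t + 1) (by omega) d hd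
        have hne : m' ≠ x.mv t := by
          rintro rfl
          exact hloop t (by omega) (h2 ▸ hd) (h4.trans h2.symm)
        exact hsat d ⟨m', hne, (x.view_succ hne).symm.trans h4⟩
      · exact hsat d ⟨m, hm, h2⟩

/-- `S` extends `s` along `ι` by `B`-processes in their initial state. -/
def ExtendsByInit (B : Template QB SB (Set (QA ⊕ QB))) {c n : ℕ} (ι : Fin c ↪ Fin n)
    (s : GState QA QB c) (S : GState QA QB n) : Prop :=
  s.1 = S.1 ∧ (∀ j, s.2 j = S.2 (ι j)) ∧ ∀ i, i ∉ Set.range ι → S.2 i = B.init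

section Embedding

variable {c : ℕ} {ι : Fin c ↪ Fin n} {s s' : GState QA QB c} {S S' : GState QA QB n}
  {e e' : GInput SA SB c} {E E' : GInput SA SB n}

theorem ExtendsByInit.view_map (h : ExtendsByInit B ι s S) (p : Proc c) :
    view S (p.map ι) = view s p := by
  cases p with
  | none => exact congrArg Sum.inl h.1.symm
  | some j => exact congrArg Sum.inr (h.2.1 j).symm

theorem map_or_not_mem_range (ι : Fin c ↪ Fin n) (m : Proc n) :
    (∃ p : Proc c, m = p.map ι) ∨ ∃ i, i ∉ Set.range ι ∧ m = some i := by
  cases m with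
  | none => exact Or.inl ⟨none, rfl⟩
  | some i =>
    by_cases hi : i ∈ Set.range ι
    · obtain ⟨j, rfl⟩ := hi
      exact Or.inl ⟨some j, rfl⟩
    · exact Or.inr ⟨i, hi, rfl⟩

theorem ExtendsByInit.conjSat_iff (h : ExtendsByInit B ι s S) (p : Proc c)
    {g : Set (QA ⊕ QB)} (hg : Sum.inr B.init ∈ g) :
    conjSat (others S (p.map ι)) g ↔ conjSat (others s p) g := by
  have hinj : Function.Injective (Option.map ι : Proc c → Proc n) :=
    Option.map_injective ι.injective
  constructor
  · rintro hs _ ⟨m, hm, rfl⟩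
    rw [← h.view_map]
    exact hs _ ⟨m.map ι, hinj.ne hm, rfl⟩
  · rintro hs _ ⟨m, hm, rfl⟩
    rcases map_or_not_mem_range ι m with ⟨m', rfl⟩ | ⟨i, hi, rfl⟩
    · rw [h.view_map]
      exact hs _ ⟨m', fun h' => hm (congrArg _ h'), rfl⟩
    · simpa [view, h.2.2 i hi] using hg

theorem ExtendsByInit.enabled_iff (hinit : conjInitAssumption A B) (h : ExtendsByInit B ι s S)
    (p : Proc c) (hE : inp E (p.map ι) = inp e p) :
    enabled A B conjSat S E (p.map ι) ↔ enabled A B conjSat s e p := by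
  rw [enabled_iff_localTrans, enabled_iff_localTrans, h.view_map, hE]
  refine exists_congr fun g => exists_congr fun v => and_congr_right fun ht => ?_
  exact h.conjSat_iff p (init_mem_of_localTrans hinit ht).2

theorem ExtendsByInit.step_iff (hinit : conjInitAssumption A B) (h : ExtendsByInit B ι s S)
    (h' : ExtendsByInit B ι s' S') (p : Proc c) (hE : inp E (p.map ι) = inp e p) :
    step A B conjSat S E (p.map ι) S' ↔ step A B conjSat s e p s' := by
  have hinj : Function.Injective (Option.map ι : Proc c → Proc n) :=
    Option.map_injective ι.injective
  rw [step_iff_localTrans, step_iff_localTrans, h.view_map, h'.view_map, hE]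
  refine exists_congr fun g => and_congr_right fun ht =>
    and_congr (h.conjSat_iff p (init_mem_of_localTrans hinit ht).2) ⟨fun H m hm => ?_,
      fun H m hm => ?_⟩
  · rw [← h.view_map, ← h'.view_map]
    exact H _ (hinj.ne hm)
  · rcases map_or_not_mem_range ι m with ⟨m', rfl⟩ | ⟨i, hi, rfl⟩
    · rw [h.view_map, h'.view_map]
      exact H _ fun h'' => hm (congrArg _ h'')
    · simp [view, h.2.2 i hi, h'.2.2 i hi]

/-- Adding `B`-processes that never leave their initial state preserves local deadlocks. -/
theorem exists_lockedFrom_map (hinit : conjInitAssumption A B) (ι : Fin c ↪ Fin n) (hc : 0 < c)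
    (x : Run A B conjSat c) (p : Proc c) (hx : lockedFrom A B conjSat x p) :
    ∃ y : Run A B conjSat n, lockedFrom A B conjSat y (p.map ι) := by
  let S : ℕ → GState QA QB n := fun t =>
    ((x.s t).1, Function.extend ι (x.s t).2 fun _ => B.init)
  let b0 : SB := (x.e 0).2 ⟨0, hc⟩
  let E : ℕ → GInput SA SB n := fun t =>
    ((x.e t).1, Function.extend ι (x.e t).2 fun _ => b0)
  have hext : ∀ t, ExtendsByInit B ι (x.s t) (S t) := by
    refine fun t => ⟨rfl, fun j => (ι.injective.extend_apply (x.s t).2 (fun _ => B.init) j).symm, fun i hi => ?_⟩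
    exact Function.extend_apply' (x.s t).2 (fun _ => B.init) i hi
  have hE : ∀ t p, inp (E t) (Option.map ι p) = inp (x.e t) p := by
    rintro t (_ | j)
    · rfl
    · exact congrArg Sum.inr (ι.injective.extend_apply (x.e t).2 (fun _ => b0) j)
  refine ⟨⟨S, E, fun t => (x.mv t).map ι, ⟨x.isInit0.1, fun i => ?_⟩, fun t => ?_,
    fun t m hm => ?_⟩, ?_⟩
  · by_cases hi : i ∈ Set.range ι
    · obtain ⟨j, rfl⟩ := hi
      rw [← (hext 0).2.1 j]
      exact x.isInit0.2 j
    · exact (hext 0).2.2 i hi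
  · exact ((hext t).step_iff hinit (hext (t + 1)) _ (hE t _)).2 (x.steps t)
  · rcases map_or_not_mem_range ι m with ⟨m', rfl⟩ | ⟨i, hi, rfl⟩
    · rw [hE, hE]
      exact x.persist t m' fun h => hm (congrArg _ h)
    · have h : ∀ t, (E t).2 i = b0 := fun t =>
        Function.extend_apply' (x.e t).2 (fun _ => b0) i hi
      simp [inp, h]
  · obtain ⟨t0, ht0⟩ := hx
    exact ⟨t0, fun t ht hen => ht0 t ht (((hext t).enabled_iff hinit p (hE t p)).1 hen)⟩

/-- Removing `B`-processes that never move preserves local deadlocks. -/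
theorem exists_lockedFrom_of_map (hinit : conjInitAssumption A B) (ι : Fin c ↪ Fin n)
    (y : Run A B conjSat n) (hmv : ∀ i, i ∉ Set.range ι → ∀ t, y.mv t ≠ some i)
    (p : Proc c) (hy : lockedFrom A B conjSat y (p.map ι)) :
    ∃ x : Run A B conjSat c, lockedFrom A B conjSat x p := by
  have hext : ∀ t, ExtendsByInit B ι ((y.s t).1, (y.s t).2 ∘ ι) (y.s t) := by
    refine fun t => ⟨rfl, fun j => rfl, fun i hi => ?_⟩
    have h := (y.const_of_not_move (T := 0) (fun t _ => hmv i hi t) (Nat.zero_le t)).1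
    exact (Sum.inr_injective h).trans (y.isInit0.2 i)
  have hE : ∀ t p, inp (y.e t) (Option.map ι p) =
      inp (n := c) ((y.e t).1, (y.e t).2 ∘ ι) p := by
    rintro t (_ | j) <;> rfl
  have hex : ∀ t, ∃ m : Proc c, y.mv t = m.map ι := by
    intro t
    rcases map_or_not_mem_range ι (y.mv t) with h | ⟨i, hi, h⟩
    · exact h
    · exact absurd h (hmv i hi t)
  choose mv hmv' using hex
  refine ⟨⟨fun t => ((y.s t).1, (y.s t).2 ∘ ι), fun t => ((y.e t).1, (y.e t).2 ∘ ι), mv,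
    ⟨y.isInit0.1, fun j => y.isInit0.2 _⟩, fun t => ?_, fun t m hm => ?_⟩, ?_⟩
  · refine ((hext t).step_iff hinit (hext (t + 1)) _ (hE t _)).1 ?_
    rw [← hmv']
    exact y.steps t
  · rw [← hE, ← hE]
    refine y.persist t _ fun h => hm ?_
    rw [hmv'] at h
    exact Option.map_injective ι.injective h
  · obtain ⟨t0, ht0⟩ := hy
    exact ⟨t0, fun t ht hen => ht0 t ht (((hext t).enabled_iff hinit p (hE t p)).2 hen)⟩

end Embedding

theorem exists_embedding_superset {c : ℕ} (K : Finset (Fin n)) (hK : K.card ≤ c) (hc : c ≤ n) :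
    ∃ ι : Fin c ↪ Fin n, ∀ i ∈ K, i ∈ Set.range ι := by
  obtain ⟨K', hKK', -, hK'⟩ := Finset.exists_subsuperset_card_eq (Finset.subset_univ K) hK
    (by simpa using hc)
  refine ⟨(K'.orderEmbOfFin hK').toEmbedding, fun i hi => ?_⟩
  have := Finset.range_orderEmbOfFin K' hK'
  exact this.symm ▸ hKK' hi

/-- The cutoff theorem for a process `p` running a template with at most `k` nontrivial guards,
all of them `1`-conjunctive. -/
theorem exists_lockedFrom_cutoff [Finite QA] [Finite QB] (hinit : conjInitAssumption A B) {k : ℕ}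
    (hkn : k + 2 ≤ n) (x : Run A B conjSat n) (p : Proc n) (hx : lockedFrom A B conjSat x p)
    (hone : ∀ t g v, localTrans A B (view (x.s t) p) (inp (x.e t) p) g v →
      g ≠ Set.univ → OneConjGuard g)
    (hcard : ∀ t, {d | ∃ v, localTrans A B (view (x.s t) p) (inp (x.e t) p) {d}ᶜ v}.ncard ≤ k) :
    ∃ (ι : Fin (k + 2) ↪ Fin n) (y : Run A B conjSat (k + 2)) (p' : Proc (k + 2)),
      p = p'.map ι ∧ lockedFrom A B conjSat y p' := by
  obtain ⟨y, K, hy, hK, hpK, hmv⟩ :=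
    exists_lockedFrom_few_movers_of_oneConj hinit k x p hx hone hcard
  obtain ⟨ι, hι⟩ := exists_embedding_superset K hK hkn
  have hp : ∃ p' : Proc (k + 2), p = p'.map ι := by
    rcases map_or_not_mem_range ι p with h | ⟨i, hi, h⟩
    · exact h
    · exact absurd (hι i (hpK i h)) hi
  obtain ⟨p', rfl⟩ := hp
  obtain ⟨z, hz⟩ := exists_lockedFrom_of_map hinit ι y
    (fun i hi => hmv i fun h => hi (hι i h)) p' hy
  exact ⟨ι, z, p', rfl, hz⟩

theorem ncard_blocking_le_ncard_ntGuards {Q Sig St : Type} [Finite St]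
    (T : Template Q Sig (Set St)) (a : St) (ha : ∀ g ∈ guardsOf T, a ∈ g) (D : Set St)
    (hD : ∀ d ∈ D, {d}ᶜ ∈ guardsOf T) : D.ncard ≤ (ntGuards T).ncard := by
  refine Set.ncard_le_ncard_of_injOn (fun d => {d}ᶜ) (fun d hd => ⟨hD d hd, ?_, ?_⟩) ?_
    (Set.toFinite _)
  · intro h
    exact absurd (h ▸ Set.mem_univ d : d ∈ ({d}ᶜ : Set St)) (by simp)
  · intro h
    exact Set.notMem_empty a (h ▸ ha _ (hD d hd))
  · intro d _ d' _ h
    exact Set.singleton_injective (compl_injective h)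

end LocalDeadlock

/-- **Conjunctive Cutoff Theorem (local deadlock detection, 1-conjunctive, non-fair).**
If the process template `U ∈ {A,B}` is `1`-conjunctive, then `|G_U| + 2` is a cutoff for
local deadlock detection in a `U`-process under non-fair executions. -/
theorem conjunctive_local_deadlock_1conj_nonfair_cutoff
    (QA QB SA SB : Type) [Fintype QA] [Fintype QB] [Fintype SA] [Fintype SB]
    (A : Template QA SA (Set (QA ⊕ QB))) (B : Template QB SB (Set (QA ⊕ QB)))
    (hinit : conjInitAssumption A B) :
    (uOneConj A → ∀ n, (ntGuards A).ncard + 2 ≤ n →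
      ((∃ x : Run A B conjSat n, lockedFrom A B conjSat x none) ↔
       (∃ x : Run A B conjSat ((ntGuards A).ncard + 2), lockedFrom A B conjSat x none))) ∧
    (uOneConj B → ∀ n, (ntGuards B).ncard + 2 ≤ n →
      ((∃ x : Run A B conjSat n, ∃ i, lockedFrom A B conjSat x (some i)) ↔
       (∃ x : Run A B conjSat ((ntGuards B).ncard + 2),
          ∃ i, lockedFrom A B conjSat x (some i)))) := by
  constructor
  · intro hone n hn
    constructor
    · rintro ⟨x, hx⟩
      have hguard : ∀ t g v, localTrans A B (view (x.s t) none) (inp (x.e t) none) g v →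
          g ≠ Set.univ → OneConjGuard g := by
        rintro t g (v | v) hv hne
        · refine hone _ g ⟨_, _, hv⟩ hne ?_
          rintro rfl
          exact (init_mem_of_localTrans hinit hv).1
        · exact hv.elim
      have hcard : ∀ t, {d | ∃ v, localTrans A B (view (x.s t) none) (inp (x.e t) none)
          {d}ᶜ v}.ncard ≤ (ntGuards A).ncard := by
        intro t
        refine ncard_blocking_le_ncard_ntGuards A _ (fun g hg => (hinit g (Or.inl hg)).1) _ ?_
        rintro d ⟨v | v, hv⟩
        · exact ⟨_, _, _, hv⟩
        · exact hv.elim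
      obtain ⟨ι, y, p', hp', hy⟩ := exists_lockedFrom_cutoff hinit hn x none hx hguard hcard
      cases p' with
      | none => exact ⟨y, hy⟩
      | some j => simp at hp'
    · rintro ⟨x, hx⟩
      exact exists_lockedFrom_map hinit (Fin.castLEEmb hn) (by omega) x none hx
  · intro hone n hn
    constructor
    · rintro ⟨x, i, hx⟩
      have hguard : ∀ t g v, localTrans A B (view (x.s t) (some i)) (inp (x.e t) (some i)) g v →
          g ≠ Set.univ → OneConjGuard g := by
        rintro t g (v | v) hv hne
        · exact hv.elim
        · refine hone _ g ⟨_, _, hv⟩ hne ?_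
          rintro rfl
          exact (init_mem_of_localTrans hinit hv).1
      have hcard : ∀ t, {d | ∃ v, localTrans A B (view (x.s t) (some i)) (inp (x.e t) (some i))
          {d}ᶜ v}.ncard ≤ (ntGuards B).ncard := by
        intro t
        refine ncard_blocking_le_ncard_ntGuards B _ (fun g hg => (hinit g (Or.inr hg)).1) _ ?_
        rintro d ⟨v | v, hv⟩
        · exact hv.elim
        · exact ⟨_, _, _, hv⟩
      obtain ⟨ι, y, p', hp', hy⟩ := exists_lockedFrom_cutoff hinit hn x (some i) hx hguard hcard
      cases p' with
      | none => simp at hp'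
      | some j => exact ⟨y, j, hy⟩
    · rintro ⟨x, i, hx⟩
      obtain ⟨y, hy⟩ := exists_lockedFrom_map hinit (Fin.castLEEmb hn) (by omega) x (some i) hx
      exact ⟨y, _, hy⟩
end GP
end

section
/- For conjunctive systems, any cutoff for local deadlock detection must grow at least quadratically in the number of states of the process template B, and cannot be bounded by any function of the number of guards: there exists a family of conjunctive process templates B_{w,h} (parameterized by a width w and a height h) whose number of states grows linearly in w + h and whose set of distinct non-trivial guards has size independent of h, such that the smallest n for which (A,B_{w,h})^(1,n) has a local deadlock grows proportionally to w · h (in particular, for each such template there is an n with a local deadlock in (A,B_{w,h})^(1,n) but none in (A,B_{w,h})^(1,n−1), and n ∈ Ω(|B_{w,h}|²)). -/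
namespace GP

variable {QA QB SA SB Gd : Type}

/-! ### The templates

The states of `B_{w,h}` are coded by natural numbers: `0` is initial, `1, …, 2h+2` is a path,
and column `k < w` consists of the two slots `2h+3+2k` and `2h+4+2k`, which lie on a cycle with
the path. Occupied slots of one parity block the path edges of the other parity, and the initial
state (of `A` and of `B`) is blocked iff every column is occupied. -/

section LowerBound

open Relation

/-- The codes outside of column `k`. -/
def offColumn (h k : ℕ) : Set ℕ := {c | ¬ (2 * h + 2 < c ∧ (c - (2 * h + 3)) / 2 = k)}

/-- The codes other than slots with a parity different from that of `q`. -/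
def parityGuard (h q : ℕ) : Set ℕ := {c | 2 * h + 2 < c → c % 2 = q % 2}

/-- The coded transitions of `B_{w,h}`, with guards given as sets of codes. -/
def Move (w h q : ℕ) (S : Set ℕ) (q' : ℕ) : Prop :=
  (q = 0 ∧ q' = 1 ∧ 0 < h ∧ ∃ k < w, S = offColumn h k) ∨
  (q = 0 ∧ q' = 0 ∧ w * h = 0 ∧ S = Set.univ) ∨
  (1 ≤ q ∧ q < 2 * h + 2 ∧ q' = q + 1 ∧ S = parityGuard h q) ∨
  (1 ≤ q ∧ q ≤ 2 * h + 2 ∧ q' = 0 ∧ S = Set.univ) ∨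
  (q = 2 * h + 2 ∧ 2 * h + 2 < q' ∧ q' < 2 * h + 2 * w + 3 ∧ S = Set.univ) ∨
  (2 * h + 2 < q ∧ q' = 1 ∧ S = Set.univ)

/-- The guard admitting every `A`-state and the `B`-states with code in `S`. -/
def codeGuard (m : ℕ) (S : Set ℕ) : Set (Unit ⊕ Fin m) :=
  {z | ∀ q : Fin m, z = Sum.inr q → q.val ∈ S}

/-- The template `A`, with a single state. -/
def tmplA (w h : ℕ) : Template Unit Unit (Set (Unit ⊕ Fin (2 * h + 2 * w + 3))) where
  init := ()
  trans := {e | 0 < h ∧ ∃ k < w, e.2.2.1 = codeGuard _ (offColumn h k)}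

/-- The template `B_{w,h}`. -/
def tmplB (w h : ℕ) :
    Template (Fin (2 * h + 2 * w + 3)) Unit (Set (Unit ⊕ Fin (2 * h + 2 * w + 3))) where
  init := ⟨0, by omega⟩
  trans := {e | ∃ S, Move w h e.1 S e.2.2.2 ∧ e.2.2.1 = codeGuard _ S}

lemma conjSat_codeGuard {m n : ℕ} (s : GState Unit (Fin m) n) (p : Proc n) (S : Set ℕ) :
    conjSat (others s p) (codeGuard m S) ↔ ∀ j, some j ≠ p → (s.2 j).val ∈ S := by
  constructor
  · intro H j hj
    exact H (Sum.inr (s.2 j)) ⟨some j, hj, rfl⟩ _ rfl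
  · rintro H x ⟨p', hp', rfl⟩ q hq
    cases p' with
    | none => simp [view] at hq
    | some j =>
      simp only [view, Sum.inr.injEq] at hq
      exact hq ▸ H j hp'

lemma Move.guard_cases {w h q q' : ℕ} {S : Set ℕ} (H : Move w h q S q') :
    (∃ k < w, S = offColumn h k) ∨ S = parityGuard h 0 ∨ S = parityGuard h 1 ∨ S = Set.univ := by
  rcases H with ⟨-, -, -, hS⟩ | ⟨-, -, -, hS⟩ | ⟨-, -, -, hS⟩ | ⟨-, -, -, hS⟩ | ⟨-, -, -, hS⟩ |
    ⟨-, -, hS⟩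
  · exact Or.inl hS
  · simp [hS]
  · rcases Nat.mod_two_eq_zero_or_one q with hq | hq
    · exact Or.inr (Or.inl (by simp [hS, parityGuard, hq]))
    · exact Or.inr (Or.inr (Or.inl (by simp [hS, parityGuard, hq])))
  all_goals simp [hS]

lemma guardsOf_cases {w h : ℕ} {g : Set (Unit ⊕ Fin (2 * h + 2 * w + 3))}
    (hg : g ∈ guardsOf (tmplA w h) ∪ guardsOf (tmplB w h)) :
    ∃ S, g = codeGuard _ S ∧ ((∃ k < w, S = offColumn h k) ∨
      S = parityGuard h 0 ∨ S = parityGuard h 1 ∨ S = Set.univ) := by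
  rcases hg with ⟨q, σ, q', -, k, hk, hg⟩ | ⟨q, σ, q', S, hS, hg⟩
  · exact ⟨_, hg, Or.inl ⟨k, hk, rfl⟩⟩
  · exact ⟨S, hg, hS.guard_cases⟩

lemma conjInitAssumption_tmpl (w h : ℕ) : conjInitAssumption (tmplA w h) (tmplB w h) := by
  intro g hg
  obtain ⟨S, rfl, hS⟩ := guardsOf_cases hg
  refine ⟨fun q hq => by simp at hq, fun q hq => ?_⟩
  have h0 : (q : ℕ) = 0 := by rw [← Sum.inr.inj hq]; rfl
  rw [h0]
  rcases hS with ⟨k, -, rfl⟩ | rfl | rfl | rfl <;> simp [offColumn, parityGuard]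

lemma ncard_ntGuards_tmpl_le (w h : ℕ) :
    (ntGuards (tmplA w h) ∪ ntGuards (tmplB w h)).ncard ≤ w + 3 := by
  classical
  let f : ℕ → Set (Unit ⊕ Fin (2 * h + 2 * w + 3)) := fun k => codeGuard _
    (if k < w then offColumn h k else if k = w then parityGuard h 0
      else if k = w + 1 then parityGuard h 1 else Set.univ)
  have hsub : ntGuards (tmplA w h) ∪ ntGuards (tmplB w h) ⊆
      ((Finset.range (w + 3)).image f : Finset _) := by
    intro g hg
    have hg' : g ∈ guardsOf (tmplA w h) ∪ guardsOf (tmplB w h) :=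
      hg.imp (fun H => H.1) (fun H => H.1)
    obtain ⟨S, rfl, hS⟩ := guardsOf_cases hg'
    rw [Finset.mem_coe, Finset.mem_image]
    rcases hS with ⟨k, hk, rfl⟩ | rfl | rfl | rfl
    · exact ⟨k, Finset.mem_range.2 (by omega), by simp [f, hk]⟩
    · exact ⟨w, Finset.mem_range.2 (by omega), by simp [f]⟩
    · exact ⟨w + 1, Finset.mem_range.2 (by omega), by simp [f]⟩
    · exact ⟨w + 2, Finset.mem_range.2 (by omega), by simp [f]⟩
  calc _ ≤ _ := Set.ncard_le_ncard hsub (Finset.finite_toSet _)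
    _ ≤ _ := by
      rw [Set.ncard_coe_finset]
      exact Finset.card_image_le.trans (by simp)

/-! ### A local deadlock needs many processes -/

/-- A single move of a process of `B_{w,h}` from code `q` to code `q'` when the initial state is
blocked, in an environment with codes `E`. -/
def ActiveMove (H q q' : ℕ) (E : Set ℕ) : Prop :=
  (1 ≤ q ∧ q < H ∧ q' = q + 1 ∧ ∀ c ∈ E, H < c → c % 2 = q % 2) ∨
  (1 ≤ q ∧ q ≤ H ∧ q' = 0) ∨ (q = H ∧ H < q') ∨ (H < q ∧ q' = 1)

section Counting

variable {w H n : ℕ} {u : ℕ → Fin n → ℕ} {mv : ℕ → Fin n}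

/-- The number of alternations between odd and even path edges crossed before time `t`. -/
def alternations (H : ℕ) (u : ℕ → Fin n → ℕ) (mv : ℕ → Fin n) : ℕ → ℕ
  | 0 => 0
  | t + 1 =>
    if (1 ≤ u t (mv t) ∧ u t (mv t) < H ∧ u (t + 1) (mv t) = u t (mv t) + 1) ∧
        u t (mv t) % 2 ≠ alternations H u mv t % 2 then
      alternations H u mv t + 1
    else alternations H u mv t

lemma alternations_succ (t : ℕ) :
    (alternations H u mv (t + 1) = alternations H u mv t + 1 ∧
      (1 ≤ u t (mv t) ∧ u t (mv t) < H ∧ u (t + 1) (mv t) = u t (mv t) + 1) ∧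
      u t (mv t) % 2 ≠ alternations H u mv t % 2) ∨
    (alternations H u mv (t + 1) = alternations H u mv t ∧
      ((1 ≤ u t (mv t) ∧ u t (mv t) < H ∧ u (t + 1) (mv t) = u t (mv t) + 1) →
      u t (mv t) % 2 = alternations H u mv t % 2)) := by
  rw [alternations]
  split_ifs with h1
  · exact Or.inl ⟨rfl, h1⟩
  · exact Or.inr ⟨rfl, fun h2 => by_contra fun h3 => h1 ⟨h2, h3⟩⟩

lemma alternations_mono : Monotone (alternations H u mv) :=
  monotone_nat_of_le_succ fun t => by
    rcases alternations_succ (H := H) (u := u) (mv := mv) t with h | h <;> omega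

/-- The number of moves from code `q` to code `e` along the cycle, plus one. -/
def cycleRank (H e q : ℕ) : ℕ :=
  if q = 0 then 0 else if q ≤ e then e - q + 1 else if q ≤ H then H - q + e + 2 else e + 1

lemma exists_alternation (hH : 3 ≤ H)
    (hmv : ∀ t, ActiveMove H (u t (mv t)) (u (t + 1) (mv t)) {c | ∃ j ≠ mv t, u t j = c})
    (hst : ∀ t, ∀ j ≠ mv t, u (t + 1) j = u t j) (t : ℕ) :
    ∃ t' ≥ t, alternations H u mv t' = alternations H u mv t ∧
      alternations H u mv (t' + 1) = alternations H u mv t + 1 := by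
  by_contra! hcon
  have hconst : ∀ m, alternations H u mv (t + m) = alternations H u mv t := by
    intro m
    induction m with
    | zero => rfl
    | succ m ih =>
      have h1 := hcon (t + m) (by omega) ih
      rcases alternations_succ (H := H) (u := u) (mv := mv) (t + m) with h | h
      · rw [ih] at h; exact absurd h.1 h1
      · rw [← ih, ← h.1]; rfl
  obtain ⟨e, he1, he2, hep⟩ : ∃ e, 1 ≤ e ∧ e ≤ 2 ∧ e % 2 ≠ alternations H u mv t % 2 := by
    rcases Nat.mod_two_eq_zero_or_one (alternations H u mv t) with h | h
    · exact ⟨1, by omega⟩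
    · exact ⟨2, by omega⟩
  have hdec : ∀ m, ∑ i, cycleRank H e (u (t + m + 1) i) < ∑ i, cycleRank H e (u (t + m) i) := by
    intro m
    have hlt : cycleRank H e (u (t + m + 1) (mv (t + m))) <
        cycleRank H e (u (t + m) (mv (t + m))) := by
      have h1 := hconst m
      have h2 := hconst (m + 1)
      rw [← add_assoc] at h2
      have h3 := alternations_succ (H := H) (u := u) (mv := mv) (t + m)
      rw [h1, h2] at h3
      have h4 := hmv (t + m)
      unfold ActiveMove at h4
      unfold cycleRank
      generalize u (t + m + 1) (mv (t + m)) = q' at *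
      generalize u (t + m) (mv (t + m)) = q at *
      have h5 : (1 ≤ q ∧ q < H ∧ q' = q + 1 ∧ q ≠ e) ∨
          (1 ≤ q ∧ q ≤ H ∧ q' = 0) ∨ (q = H ∧ H < q') ∨ (H < q ∧ q' = 1) := by
        rcases h4 with ⟨a, b, c, -⟩ | h4
        · refine Or.inl ⟨a, b, c, ?_⟩
          rintro rfl
          omega
        · exact Or.inr h4
      clear h3 h4 hcon
      split_ifs <;> omega
    refine Finset.sum_lt_sum (fun i _ => ?_) ⟨mv (t + m), Finset.mem_univ _, hlt⟩
    by_cases hi : i = mv (t + m)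
    · rw [hi]; exact hlt.le
    · rw [hst _ i hi]
  have hsum : ∀ m, ∑ i, cycleRank H e (u (t + m) i) + m ≤ ∑ i, cycleRank H e (u t i) := by
    intro m
    induction m with
    | zero => simp
    | succ m ih => have := hdec m; rw [← add_assoc t m 1]; omega
  have := hsum (∑ i, cycleRank H e (u t i) + 1)
  omega

lemma exists_alternation_eq (hH : 3 ≤ H)
    (hmv : ∀ t, ActiveMove H (u t (mv t)) (u (t + 1) (mv t)) {c | ∃ j ≠ mv t, u t j = c})
    (hst : ∀ t, ∀ j ≠ mv t, u (t + 1) j = u t j) (j : ℕ) :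
    ∃ t, alternations H u mv t = j ∧ alternations H u mv (t + 1) = j + 1 := by
  induction j with
  | zero =>
    obtain ⟨t, -, h1, h2⟩ := exists_alternation hH hmv hst 0
    exact ⟨t, h1, h2⟩
  | succ j ih =>
    obtain ⟨t, -, h2⟩ := ih
    obtain ⟨t', -, h3, h4⟩ := exists_alternation hH hmv hst (t + 1)
    exact ⟨t', h3.trans h2, by rw [h4, h2]⟩

/-- A process occupying a slot of parity `j` at the `j`-th alternation can advance at most one path
edge per alternation, until it reaches a slot again. -/
lemma slot_progress (hH : 1 ≤ H)
    (hmv : ∀ t, ActiveMove H (u t (mv t)) (u (t + 1) (mv t)) {c | ∃ j ≠ mv t, u t j = c})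
    (hst : ∀ t, ∀ j ≠ mv t, u (t + 1) j = u t j) {j T : ℕ} {i : Fin n}
    (hT : alternations H u mv (T + 1) = j) (hi : H < u (T + 1) i) (hp : u (T + 1) i % 2 = j % 2)
    (m : ℕ) :
    (H < u (T + 1 + m) i ∧ u (T + 1 + m) i % 2 = j % 2 ∧
      alternations H u mv (T + 1 + m) = j) ∨
    u (T + 1 + m) i = 0 ∨
    (1 ≤ u (T + 1 + m) i ∧ u (T + 1 + m) i ≤ H ∧
      u (T + 1 + m) i + j ≤ alternations H u mv (T + 1 + m) + (1 + j % 2)) ∨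
    (H < u (T + 1 + m) i ∧ H + j ≤ alternations H u mv (T + 1 + m) + (1 + j % 2)) := by
  induction m with
  | zero => exact Or.inl ⟨hi, hp, hT⟩
  | succ m ih =>
    rw [← add_assoc (T + 1) m 1]
    generalize T + 1 + m = t at *
    have h1 := alternations_succ (H := H) (u := u) (mv := mv) t
    have h2 := hmv t
    generalize alternations H u mv (t + 1) = f' at *
    generalize alternations H u mv t = f at *
    by_cases hit : i = mv t
    · rw [← hit] at h1 h2
      have h3 : (1 ≤ u t i ∧ u t i < H ∧ u (t + 1) i = u t i + 1) ∨
          (1 ≤ u t i ∧ u t i ≤ H ∧ u (t + 1) i = 0) ∨ (u t i = H ∧ H < u (t + 1) i) ∨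
          (H < u t i ∧ u (t + 1) i = 1) :=
        h2.imp (fun h => ⟨h.1, h.2.1, h.2.2.1⟩) id
      clear h2
      generalize u t i = q at *
      generalize u (t + 1) i = q' at *
      omega
    · rw [hst t i hit]
      have h3 : 1 ≤ u t (mv t) ∧ u t (mv t) < H ∧ u (t + 1) (mv t) = u t (mv t) + 1 →
          H < u t i → u t i % 2 = u t (mv t) % 2 := by
        intro h4 h5
        rcases h2 with ⟨-, -, -, h⟩ | h
        · exact h _ ⟨i, hit, rfl⟩ h5
        · omega
      clear h2
      generalize u t i = q at *
      omega

lemma card_ge_of_covered (hH : 3 ≤ H)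
    (hcov : ∀ t, ∀ k < w, ∃ i, H < u t i ∧ (u t i - (H + 1)) / 2 = k)
    (hmv : ∀ t, ActiveMove H (u t (mv t)) (u (t + 1) (mv t)) {c | ∃ j ≠ mv t, u t j = c})
    (hst : ∀ t, ∀ j ≠ mv t, u (t + 1) j = u t j) :
    w * (H - 1) ≤ n := by
  choose T hT1 hT2 using exists_alternation_eq hH hmv hst
  have hocc : ∀ j k, ∃ i, k < w → H < u (T j) i ∧ (u (T j) i - (H + 1)) / 2 = k := by
    intro j k
    by_cases hk : k < w
    · obtain ⟨i, hi⟩ := hcov (T j) k hk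
      exact ⟨i, fun _ => hi⟩
    · exact ⟨mv 0, fun h => absurd h hk⟩
  choose occ hocc using hocc
  have hcross : ∀ j i, H < u (T j) i →
      u (T j + 1) i = u (T j) i ∧ u (T j) i % 2 = (j + 1) % 2 := by
    intro j i hi
    have h1 := alternations_succ (H := H) (u := u) (mv := mv) (T j)
    rw [hT1, hT2] at h1
    have hne : i ≠ mv (T j) := by rintro rfl; omega
    refine ⟨hst _ _ hne, ?_⟩
    rcases hmv (T j) with ⟨-, -, -, h⟩ | h
    · have := h _ ⟨i, hne, rfl⟩ hi
      omega
    · omega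
  have hsep : ∀ j j' i, j < j' → j' < j + (H - 1) → H < u (T j) i → H < u (T j') i → False := by
    intro j j' i hjj hj' hi hi'
    have hlt : T j < T j' := by
      by_contra! hle
      have := alternations_mono (H := H) (u := u) (mv := mv) hle
      rw [hT1, hT1] at this
      omega
    obtain ⟨m, hm⟩ : ∃ m, T j' = T j + 1 + m := ⟨T j' - (T j + 1), by omega⟩
    obtain ⟨h1, h2⟩ := hcross j i hi
    have h3 := slot_progress (by omega) hmv hst (hT2 j) (by omega : H < u (T j + 1) i) (by omega) m
    rw [← hm, hT1] at h3
    have h4 := (hcross j' i hi').2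
    omega
  have hinj : Function.Injective (fun x : Fin w × Fin (H - 1) => occ x.2 x.1) := by
    rintro ⟨⟨k, hk⟩, ⟨j, hj⟩⟩ ⟨⟨k', hk'⟩, ⟨j', hj'⟩⟩ heq
    simp only at heq
    obtain ⟨h1, h2⟩ := hocc j k hk
    obtain ⟨h3, h4⟩ := hocc j' k' hk'
    have hjj : j = j' := by
      rcases lt_trichotomy j j' with h | h | h
      · exact (hsep j j' _ h (by omega) h1 (heq ▸ h3)).elim
      · exact h
      · exact (hsep j' j _ h (by omega) h3 (heq ▸ h1)).elim
    subst hjj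
    have hkk : k = k' := by rw [← h2, ← h4, heq]
    subst hkk
    rfl
  simpa using Fintype.card_le_of_injective _ hinj

end Counting

lemma exists_mem_column {w h n : ℕ} (hh : 0 < h)
    {s : GState Unit (Fin (2 * h + 2 * w + 3)) n} {e : GInput Unit Unit n} {p : Proc n}
    (hp : ¬ enabled (tmplA w h) (tmplB w h) conjSat s e p) {k : ℕ} (hk : k < w) :
    ∃ i, 2 * h + 2 < (s.2 i).val ∧ ((s.2 i).val - (2 * h + 3)) / 2 = k := by
  suffices hs : ¬ conjSat (others s p) (codeGuard _ (offColumn h k)) by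
    rw [conjSat_codeGuard] at hs
    push Not at hs
    obtain ⟨i, -, hi⟩ := hs
    exact ⟨i, not_not.1 hi⟩
  intro hs
  apply hp
  cases p with
  | none => exact ⟨_, (), ⟨hh, k, hk, rfl⟩, hs⟩
  | some i =>
    have huniv : conjSat (others s (some i)) (codeGuard (2 * h + 2 * w + 3) Set.univ) :=
      (conjSat_codeGuard ..).2 fun _ _ => trivial
    rcases Nat.eq_zero_or_pos (s.2 i).val with h0 | h0
    · exact ⟨_, ⟨1, by omega⟩, ⟨_, Or.inl ⟨h0, rfl, hh, k, hk, rfl⟩, rfl⟩, hs⟩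
    · rcases le_or_gt (s.2 i).val (2 * h + 2) with h1 | h1
      · exact ⟨_, ⟨0, by omega⟩,
          ⟨_, Or.inr (Or.inr (Or.inr (Or.inl ⟨h0, h1, rfl, rfl⟩))), rfl⟩, huniv⟩
      · exact ⟨_, ⟨1, by omega⟩,
          ⟨_, Or.inr (Or.inr (Or.inr (Or.inr (Or.inr ⟨h1, rfl, rfl⟩)))), rfl⟩, huniv⟩

lemma exists_activeMove {w h n : ℕ} (hw : 0 < w) (hh : 0 < h)
    {s s' : GState Unit (Fin (2 * h + 2 * w + 3)) n} {e : GInput Unit Unit n} {p : Proc n}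
    (hcov : ∀ k < w, ∃ i, 2 * h + 2 < (s.2 i).val ∧ ((s.2 i).val - (2 * h + 3)) / 2 = k)
    (hstep : step (tmplA w h) (tmplB w h) conjSat s e p s') :
    ∃ i, ActiveMove (2 * h + 2) (s.2 i).val (s'.2 i).val {c | ∃ j ≠ i, (s.2 j).val = c} ∧
      ∀ j ≠ i, s'.2 j = s.2 j := by
  cases p with
  | none =>
    obtain ⟨g, q', ⟨-, k, hk, rfl⟩, hsat, -⟩ := hstep
    obtain ⟨j, hj⟩ := hcov k hk
    exact ((conjSat_codeGuard ..).1 hsat j (by simp) hj).elim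
  | some i =>
    obtain ⟨g, q', ⟨S, hS, hg⟩, hsat, rfl⟩ := hstep
    simp only at hg hS
    subst hg
    rw [conjSat_codeGuard] at hsat
    refine ⟨i, ?_, fun j hj => Function.update_of_ne hj _ _⟩
    simp only [Function.update_self]
    rcases hS with ⟨h0, -, -, k, hk, rfl⟩ | ⟨-, -, h0, -⟩ | ⟨h1, h2, h3, rfl⟩ | ⟨h1, h2, h3, -⟩ |
      ⟨h1, h2, -⟩ | ⟨h1, h2, -⟩
    · obtain ⟨j, hj⟩ := hcov k hk
      refine (hsat j ?_ hj).elim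
      simp only [ne_eq, Option.some.injEq]
      rintro rfl
      omega
    · exact absurd h0 (Nat.mul_pos hw hh).ne'
    · refine Or.inl ⟨h1, h2, h3, ?_⟩
      rintro c ⟨j, hj, rfl⟩ hc
      exact hsat j (by simpa using hj) hc
    · exact Or.inr (Or.inl ⟨h1, h2, h3⟩)
    · exact Or.inr (Or.inr (Or.inl ⟨h1, h2⟩))
    · exact Or.inr (Or.inr (Or.inr ⟨h1, h2⟩))

lemma mul_le_of_hasLocalDeadlock {w h n : ℕ}
    (hd : hasLocalDeadlock (tmplA w h) (tmplB w h) conjSat n) : w * h ≤ n := by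
  rcases Nat.eq_zero_or_pos w with rfl | hw
  · simp
  rcases Nat.eq_zero_or_pos h with rfl | hh
  · simp
  obtain ⟨x, p, t0, hp⟩ := hd
  have hcov : ∀ t, ∀ k < w, ∃ i, 2 * h + 2 < ((x.s (t0 + t)).2 i).val ∧
      (((x.s (t0 + t)).2 i).val - (2 * h + 3)) / 2 = k := fun t k hk =>
    exists_mem_column hh (hp (t0 + t) (by omega)) hk
  choose mv hmv hst using fun t => exists_activeMove hw hh (hcov t) (x.steps (t0 + t))
  have := card_ge_of_covered (u := fun t i => ((x.s (t0 + t)).2 i).val) (by omega) hcov hmv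
    (fun t j hj => congrArg _ (hst t j hj))
  exact (Nat.mul_le_mul_left w (by omega)).trans this

lemma not_hasLocalDeadlock_zero (w h : ℕ) :
    ¬ hasLocalDeadlock (tmplA w h) (tmplB w h) conjSat 0 := by
  rintro ⟨x, p, t0, hp⟩
  have hstep := x.steps t0
  have hdis := hp t0 le_rfl
  rcases p with - | i
  · rcases hm : x.mv t0 with - | j
    · rw [hm] at hstep
      obtain ⟨g, q', h1, h2, -⟩ := hstep
      exact hdis ⟨g, q', h1, h2⟩
    · exact j.elim0
  · exact i.elim0

/-! ### A local deadlock with few processes -/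

/-- One step of a `B`-process on coded states. -/
def CodeStep (w h : ℕ) {n : ℕ} (v v' : Fin n → ℕ) : Prop :=
  ∃ i S q', Move w h (v i) S q' ∧ (∀ j ≠ i, v j ∈ S) ∧ v' = Function.update v i q'

/-- Every column is occupied. -/
def Covered (w h : ℕ) {n : ℕ} (v : Fin n → ℕ) : Prop :=
  ∀ k < w, ∃ i, 2 * h + 2 < v i ∧ (v i - (2 * h + 3)) / 2 = k

/-- Moving processes one by one, in any order. -/
lemma reflTransGen_of_moves {w h n : ℕ} {I : (Fin n → ℕ) → Prop} {s s' : Fin n → ℕ}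
    (hI : ∀ v : Fin n → ℕ, (∀ i, v i = s i ∨ v i = s' i) → I v)
    (hmove : ∀ i, s i = s' i ∨ ∃ S, Move w h (s i) S (s' i) ∧ ∀ j, s j ∈ S ∧ s' j ∈ S ∨ j = i) :
    ReflTransGen (fun v v' => CodeStep w h v v' ∧ I v) s s' := by
  classical
  have key : ∀ F : Finset (Fin n), ReflTransGen (fun v v' => CodeStep w h v v' ∧ I v) s
      (fun i => if i ∈ F then s' i else s i) := by
    intro F
    induction F using Finset.induction_on with
    | empty => simpa using ReflTransGen.refl
    | insert a F ha ih =>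
      have hupd : (fun i => if i ∈ insert a F then s' i else s i) =
          Function.update (fun i => if i ∈ F then s' i else s i) a (s' a) := by
        funext i
        by_cases hi : i = a
        · subst hi; simp
        · simp [hi]
      rw [hupd]
      rcases hmove a with h1 | ⟨S, hS, hsat⟩
      · rwa [Function.update_eq_self_iff.2 (by simp [ha, h1])]
      · refine ih.tail ⟨⟨a, S, s' a, by simpa [ha] using hS, fun j hj => ?_, rfl⟩, hI _ fun i => ?_⟩
        · have := (hsat j).resolve_right hj
          beta_reduce
          split_ifs
          exacts [this.2, this.1]
        · split_ifs
          exacts [Or.inr rfl, Or.inl rfl]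
  simpa using key Finset.univ

/-- The number of rounds, modulo `2h+4`, since group `g` last occupied slots. -/
def groupAge (h j g : ℕ) : ℕ := (j + (2 * h + 4 - g)) % (2 * h + 4)

lemma groupAge_lt (h j g : ℕ) : groupAge h j g < 2 * h + 4 := Nat.mod_lt _ (by omega)

lemma groupAge_succ (h j g : ℕ) :
    groupAge h (j + 1) g = if groupAge h j g = 2 * h + 3 then 0 else groupAge h j g + 1 := by
  have h1 := Nat.mod_add_div (j + (2 * h + 4 - g)) (2 * h + 4)
  have h2 := groupAge_lt h j g
  unfold groupAge at *
  generalize (j + (2 * h + 4 - g)) / (2 * h + 4) = c at *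
  have h3 : j + 1 + (2 * h + 4 - g) =
      ((j + (2 * h + 4 - g)) % (2 * h + 4) + 1) + (2 * h + 4) * c := by omega
  rw [h3, Nat.add_mul_mod_self_left]
  split_ifs with h4
  · rw [h4, Nat.mod_self]
  · exact Nat.mod_eq_of_lt (by omega)

lemma groupAge_parity {h g : ℕ} (j : ℕ) (hg : g < 2 * h + 4) :
    groupAge h j g % 2 = (j + g) % 2 := by
  unfold groupAge
  rw [Nat.mod_mod_of_dvd _ ⟨h + 2, by ring⟩]
  omega

lemma exists_groupAge_eq_zero (h j : ℕ) : ∃ g < 2 * h + 4, groupAge h j g = 0 := by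
  refine ⟨j % (2 * h + 4), Nat.mod_lt _ (by omega), ?_⟩
  have h1 := Nat.mod_add_div j (2 * h + 4)
  have h2 := Nat.mod_lt j (by omega : 0 < 2 * h + 4)
  unfold groupAge
  generalize j % (2 * h + 4) = r at *
  generalize j / (2 * h + 4) = c at *
  have h3 : j + (2 * h + 4 - r) = 0 + (2 * h + 4) * (c + 1) := by rw [mul_add]; omega
  rw [h3, Nat.add_mul_mod_self_left, Nat.zero_mod]

/-- The code in round `j` of the `k`-th process in group `g`. -/
def roundCode (h j g k : ℕ) : ℕ :=
  if groupAge h j g = 0 then 2 * h + 4 + 2 * k - j % 2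
  else min (groupAge h j g + (1 - g % 2)) (2 * h + 2)

/-- The configuration in round `j`, with `2h+4` groups of `w` processes. -/
def roundConfig (w h j : ℕ) (i : Fin ((2 * h + 4) * w)) : ℕ :=
  roundCode h j (i / w) (i % w)

lemma exists_index {w h g k : ℕ} (hg : g < 2 * h + 4) (hk : k < w) :
    ∃ i : Fin ((2 * h + 4) * w), (i : ℕ) / w = g ∧ (i : ℕ) % w = k := by
  have hlt : g * w + k < (2 * h + 4) * w := by
    calc g * w + k < g * w + w := by omega
      _ = (g + 1) * w := by ring
      _ ≤ _ := Nat.mul_le_mul_right w hg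
  refine ⟨⟨g * w + k, hlt⟩, ?_, ?_⟩
  · change (g * w + k) / w = g
    rw [Nat.mul_comm, Nat.mul_add_div (by omega), Nat.div_eq_of_lt hk, add_zero]
  · change (g * w + k) % w = k
    rw [Nat.mul_comm, Nat.mul_add_mod, Nat.mod_eq_of_lt hk]

lemma index_bounds {w h : ℕ} (hw : 0 < w) (i : Fin ((2 * h + 4) * w)) :
    (i : ℕ) / w < 2 * h + 4 ∧ (i : ℕ) % w < w :=
  ⟨(Nat.div_lt_iff_lt_mul hw).2 i.2, Nat.mod_lt _ hw⟩

lemma roundConfig_reach {w h : ℕ} (hw : 0 < w) (hh : 0 < h) :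
    ReflTransGen (CodeStep w h) (fun _ : Fin ((2 * h + 4) * w) => 0) (roundConfig w h 0) := by
  let tgt : Fin ((2 * h + 4) * w) → ℕ := fun i => min (roundConfig w h 0 i) (2 * h + 2)
  have bulk : ∀ {s s' : Fin ((2 * h + 4) * w) → ℕ}, (∀ i, s i = s' i ∨ ∃ S,
      Move w h (s i) S (s' i) ∧ ∀ j, s j ∈ S ∧ s' j ∈ S ∨ j = i) →
      ReflTransGen (CodeStep w h) s s' := fun hm =>
    ReflTransGen.mono (fun _ _ h => h.1) _ _
      (reflTransGen_of_moves (I := fun _ => True) (fun _ _ => trivial) hm)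
  have hpath : ∀ m, ReflTransGen (CodeStep w h) (fun _ => 0) (fun i => min m (tgt i)) := by
    intro m
    induction m with
    | zero => simpa using ReflTransGen.refl
    | succ m ih =>
      refine ih.trans (bulk fun i => ?_)
      have hb : ∀ j, tgt j ≤ 2 * h + 2 := fun j => min_le_right _ _
      rcases le_or_gt (tgt i) m with hm | hm
      · left; omega
      right
      have hi := hb i
      rcases Nat.eq_zero_or_pos m with rfl | h0
      · refine ⟨_, Or.inl ⟨by omega, by omega, hh, 0, hw, rfl⟩, fun j => Or.inl ?_⟩
        have := hb j
        simp only [offColumn, Set.mem_ofPred_eq]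
        omega
      · refine ⟨_, Or.inr (Or.inr (Or.inl ⟨by omega, by omega, by omega, rfl⟩)),
          fun j => Or.inl ?_⟩
        have := hb j
        simp only [parityGuard, Set.mem_ofPred_eq]
        omega
  refine (hpath (2 * h + 2)).trans (bulk fun i => ?_)
  simp only [tgt]
  obtain ⟨h1, h2⟩ := index_bounds hw i
  rcases le_or_gt (roundConfig w h 0 i) (2 * h + 2) with hm | hm
  · left; omega
  right
  refine ⟨_, Or.inr (Or.inr (Or.inr (Or.inr (Or.inl ⟨by omega, hm, ?_, rfl⟩)))),
    fun j => Or.inl ⟨trivial, trivial⟩⟩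
  unfold roundConfig roundCode
  split_ifs <;> omega

lemma roundConfig_succ {w h : ℕ} (hw : 0 < w) (j : ℕ) :
    TransGen (fun v v' => CodeStep w h v v' ∧ Covered w h v)
      (roundConfig w h j) (roundConfig w h (j + 1)) := by
  let d : Fin ((2 * h + 4) * w) → ℕ := fun i => groupAge h j (i / w)
  let D₁ : Fin ((2 * h + 4) * w) → ℕ := fun i =>
    if d i = 2 * h + 3 then roundConfig w h (j + 1) i else roundConfig w h j i
  let D₂ : Fin ((2 * h + 4) * w) → ℕ := fun i =>
    if d i = 2 * h + 3 then roundConfig w h (j + 1) i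
    else if d i = 0 then 1 else roundConfig w h j i
  have hb := index_bounds (h := h) hw
  have hd : ∀ i, d i < 2 * h + 4 := fun i => groupAge_lt ..
  have hpar : ∀ i, d i % 2 = (j + i / w) % 2 := fun i => groupAge_parity j (hb i).1
  have hC : ∀ i, roundConfig w h j i = if d i = 0 then 2 * h + 4 + 2 * (i % w) - j % 2
      else min (d i + (1 - i / w % 2)) (2 * h + 2) := fun i => rfl
  have hC' : ∀ i, roundConfig w h (j + 1) i =
      if d i = 2 * h + 3 then 2 * h + 4 + 2 * (i % w) - (j + 1) % 2
      else min (d i + 1 + (1 - i / w % 2)) (2 * h + 2) := by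
    intro i
    unfold roundConfig roundCode
    rw [groupAge_succ]
    by_cases hi : groupAge h j (i / w) = 2 * h + 3 <;> simp [d, hi]
  have hcov : ∀ a : ℕ, (∀ k < w, ∃ i : Fin ((2 * h + 4) * w), d i = a ∧ (i : ℕ) % w = k) →
      ∀ s s' : Fin ((2 * h + 4) * w) → ℕ,
      (∀ i, d i = a → s i = s' i ∧ 2 * h + 2 < s i ∧ (s i - (2 * h + 3)) / 2 = i % w) →
      ∀ v : Fin ((2 * h + 4) * w) → ℕ, (∀ i, v i = s i ∨ v i = s' i) → Covered w h v := by
    intro a ha s s' hs v hv k hk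
    obtain ⟨i, hi, rfl⟩ := ha k hk
    have h1 := hs i hi
    have h2 : v i = s i := (hv i).elim id fun h => h.trans h1.1.symm
    exact ⟨i, by rw [h2]; exact h1.2⟩
  have hold : ∀ k < w, ∃ i : Fin ((2 * h + 4) * w), d i = 0 ∧ (i : ℕ) % w = k := by
    intro k hk
    obtain ⟨g, hg, hg0⟩ := exists_groupAge_eq_zero h j
    obtain ⟨i, rfl, h2⟩ := exists_index hg hk
    exact ⟨i, hg0, h2⟩
  have hnew : ∀ k < w, ∃ i : Fin ((2 * h + 4) * w), d i = 2 * h + 3 ∧ (i : ℕ) % w = k := by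
    intro k hk
    obtain ⟨g, hg, hg0⟩ := exists_groupAge_eq_zero h (j + 1)
    obtain ⟨i, rfl, h2⟩ := exists_index hg hk
    refine ⟨i, ?_, h2⟩
    rw [groupAge_succ] at hg0
    split_ifs at hg0 with h3
    exact h3
  have step₁ : ReflTransGen (fun v v' => CodeStep w h v v' ∧ Covered w h v)
      (roundConfig w h j) D₁ := by
    refine reflTransGen_of_moves (hcov 0 hold _ _ fun i hi => ?_) fun i => ?_
    · simp only [D₁, hC, hi]
      refine ⟨by simp, ?_⟩
      simp only [if_true]
      omega
    · by_cases hi : d i = 2 * h + 3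
      · right
        refine ⟨Set.univ, Or.inr (Or.inr (Or.inr (Or.inr (Or.inl ⟨?_, ?_, ?_, rfl⟩)))),
          fun _ => Or.inl ⟨trivial, trivial⟩⟩
        · rw [hC, if_neg (by omega)]; omega
        · simp only [D₁, if_pos hi, hC']; omega
        · have := (hb i).2
          simp only [D₁, if_pos hi, hC']; omega
      · left; simp only [D₁, if_neg hi]
  have step₂ : ReflTransGen (fun v v' => CodeStep w h v v' ∧ Covered w h v) D₁ D₂ := by
    refine reflTransGen_of_moves (hcov _ hnew _ _ fun i hi => ?_) fun i => ?_
    · simp only [D₁, D₂, hC', if_pos hi]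
      refine ⟨trivial, ?_⟩
      omega
    · by_cases hi : d i = 0
      · right
        refine ⟨Set.univ, Or.inr (Or.inr (Or.inr (Or.inr (Or.inr ⟨?_, ?_, rfl⟩)))),
          fun _ => Or.inl ⟨trivial, trivial⟩⟩
        · simp only [D₁]
          rw [if_neg (by omega), hC, if_pos hi]; omega
        · simp only [D₂]
          rw [if_neg (by omega), if_pos hi]
      · left; simp only [D₁, D₂, if_neg hi]
  have step₃ : ReflTransGen (fun v v' => CodeStep w h v v' ∧ Covered w h v) D₂
      (roundConfig w h (j + 1)) := by
    refine reflTransGen_of_moves (hcov _ hnew _ _ fun i hi => ?_) fun i => ?_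
    · simp only [D₂, hC', if_pos hi]
      refine ⟨trivial, ?_⟩
      omega
    · by_cases heq : D₂ i = roundConfig w h (j + 1) i
      · exact Or.inl heq
      right
      have h1 : d i ≠ 2 * h + 3 := fun hi => heq (if_pos hi)
      have h2 := hpar i
      have h3 := hd i
      have h4 : 1 ≤ D₂ i ∧ D₂ i < 2 * h + 2 ∧ roundConfig w h (j + 1) i = D₂ i + 1 ∧
          D₂ i % 2 = (j + 1) % 2 := by
        simp only [D₂, hC', hC, if_neg h1] at heq ⊢
        split_ifs at heq ⊢ with h5 <;> omega
      refine ⟨_, Or.inr (Or.inr (Or.inl ⟨h4.1, h4.2.1, h4.2.2.1, rfl⟩)), fun l => Or.inl ?_⟩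
      simp only [parityGuard, Set.mem_ofPred_eq, h4.2.2.2]
      simp only [D₂, hC', hC]
      constructor <;> split_ifs <;> omega
  refine (reflTransGen_iff_eq_or_transGen.1 ((step₁.trans step₂).trans step₃)).resolve_left ?_
  intro heq
  obtain ⟨i, hi, -⟩ := hold 0 hw
  have h1 := congrFun heq i
  rw [hC, hC', if_pos hi, if_neg (by omega)] at h1
  omega

lemma exists_covered_codePath {w h : ℕ} (hw : 0 < w) (hh : 0 < h) :
    ∃ f : ℕ → Fin ((2 * h + 4) * w) → ℕ, f 0 = (fun _ => 0) ∧
      (∀ t, CodeStep w h (f t) (f (t + 1))) ∧ ∃ t0, ∀ t ≥ t0, Covered w h (f t) := by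
  refine (roundConfig_reach hw hh).head_induction_on (motive := fun s _ => ∃ f : ℕ → _, f 0 = s ∧
      (∀ t, CodeStep w h (f t) (f (t + 1))) ∧ ∃ t0, ∀ t ≥ t0, Covered w h (f t)) ?_ ?_
  · let R : (Fin ((2 * h + 4) * w) → ℕ) → (Fin ((2 * h + 4) * w) → ℕ) → Prop :=
      fun v' v => CodeStep w h v v' ∧ Covered w h v
    have hacc : ¬ Acc R (roundConfig w h 0) := by
      rw [← acc_transGen_iff, not_acc_iff_exists_descending_chain]
      exact ⟨fun j => roundConfig w h j, rfl, fun j => transGen_swap.1 (roundConfig_succ hw j)⟩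
    obtain ⟨f, hf0, hf⟩ := not_acc_iff_exists_descending_chain.1 hacc
    exact ⟨f, hf0, fun t => (hf t).1, 0, fun t _ => (hf t).2⟩
  · rintro s s' hs - ⟨f, hf0, hf, t0, hcov⟩
    refine ⟨fun t => Nat.casesOn t s f, rfl, ?_, t0 + 1, ?_⟩
    · rintro (- | t)
      · simpa [hf0] using hs
      · exact hf t
    · rintro (- | t) ht
      · omega
      · exact hcov t (by omega)

lemma hasLocalDeadlock_of_codePath {w h n : ℕ} (f : ℕ → Fin n → ℕ) (hf0 : f 0 = fun _ => 0)
    (hf : ∀ t, CodeStep w h (f t) (f (t + 1)))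
    (hcov : ∃ t0, ∀ t ≥ t0, 0 < h → Covered w h (f t)) :
    hasLocalDeadlock (tmplA w h) (tmplB w h) conjSat n := by
  have hlt : ∀ t i, f t i < 2 * h + 2 * w + 3 := by
    intro t
    induction t with
    | zero => intro i; rw [hf0]; dsimp only; omega
    | succ t ih =>
      intro i
      obtain ⟨i', S, q', hM, -, hu⟩ := hf t
      rw [hu]
      by_cases hi : i = i'
      · subst hi
        rw [Function.update_self]
        unfold Move at hM
        omega
      · rw [Function.update_of_ne hi]; exact ih i
  choose mv S q' hM hS hu using hf
  have hq' : ∀ t, q' t < 2 * h + 2 * w + 3 := fun t => by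
    have := hlt (t + 1) (mv t)
    rwa [hu, Function.update_self] at this
  obtain ⟨t0, ht0⟩ := hcov
  refine ⟨{ s := fun t => ((), fun i => ⟨f t i, hlt t i⟩)
            e := fun _ => ((), fun _ => ())
            mv := fun t => some (mv t)
            isInit0 := ⟨rfl, fun i => Fin.ext (congrFun hf0 i)⟩
            steps := fun t => ⟨codeGuard _ (S t), ⟨q' t, hq' t⟩, ⟨S t, hM t, rfl⟩, ?_, ?_⟩
            persist := fun _ _ _ => rfl }, none, t0, ?_⟩
  · exact (conjSat_codeGuard ..).2 fun j hj => hS t j (by simpa using hj)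
  · refine Prod.ext rfl (funext fun i => Fin.ext ?_)
    change f (t + 1) i = _
    rw [hu]
    by_cases hi : i = mv t
    · subst hi; simp
    · simp [Function.update_of_ne hi]
  · rintro t ht ⟨g, q, ⟨hh, k, hk, hg⟩, hsat⟩
    simp only at hg
    subst hg
    obtain ⟨i, hi⟩ := ht0 t ht hh k hk
    exact (conjSat_codeGuard ..).1 hsat i (by simp) hi

lemma exists_hasLocalDeadlock (w h : ℕ) :
    ∃ n ≤ 6 * (w * h) + 1, hasLocalDeadlock (tmplA w h) (tmplB w h) conjSat n := by
  rcases Nat.eq_zero_or_pos (w * h) with h0 | h0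
  · refine ⟨1, by omega, hasLocalDeadlock_of_codePath (fun _ _ => 0) rfl (fun t => ?_)
      ⟨0, fun t _ hh k hk => ?_⟩⟩
    · exact ⟨0, Set.univ, 0, Or.inr (Or.inl ⟨rfl, rfl, h0, rfl⟩), fun _ _ => trivial, by simp⟩
    · exact absurd h0 (Nat.mul_pos (by omega) hh).ne'
  · have hw := Nat.pos_of_mul_pos_right h0
    have hh := Nat.pos_of_mul_pos_left h0
    obtain ⟨f, hf0, hf, t0, hcov⟩ := exists_covered_codePath hw hh
    exact ⟨_, by nlinarith, hasLocalDeadlock_of_codePath f hf0 hf ⟨t0, fun t ht _ => hcov t ht⟩⟩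

end LowerBound

/-- **Quadratic lower bound for local deadlock detection cutoffs in conjunctive systems.**
There is a family of conjunctive process templates `B_{w,h}` whose number of states grows
linearly in `w + h`, whose number of distinct non-trivial guards is independent of `h`,
and such that the smallest number `N w h` of processes admitting a local deadlock grows
proportionally to `w · h`; in particular a local deadlock exists for `N w h` processes but
not for fewer, and along the diagonal `N` is in `Ω(|B_{w,h}|²)`.  Hence cutoffs for local
deadlock detection in conjunctive systems grow at least quadratically in the number of
states and cannot be bounded in terms of the number of guards. -/
theorem conjunctive_local_deadlock_quadratic_lower_bound :
    ∃ (size : ℕ → ℕ → ℕ) (QA SA SB : Type)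
      (Afam : ∀ w h, Template QA SA (Set (QA ⊕ Fin (size w h))))
      (Bfam : ∀ w h, Template (Fin (size w h)) SB (Set (QA ⊕ Fin (size w h))))
      (N : ℕ → ℕ → ℕ) (c₁ c₂ : ℕ) (gb : ℕ → ℕ),
      0 < c₁ ∧ 0 < c₂ ∧
      (∀ w h, conjInitAssumption (Afam w h) (Bfam w h)) ∧
      -- the number of states grows linearly in w + h
      (∀ w h, size w h ≤ c₁ * (w + h) + c₁) ∧
      (∀ w h, w + h ≤ c₁ * size w h + c₁) ∧
      -- the number of distinct non-trivial guards is independent of h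
      (∀ w h, (ntGuards (Afam w h) ∪ ntGuards (Bfam w h)).ncard ≤ gb w) ∧
      -- N w h is the smallest system size admitting a local deadlock
      (∀ w h, 0 < N w h) ∧
      (∀ w h, hasLocalDeadlock (Afam w h) (Bfam w h) conjSat (N w h)) ∧
      (∀ w h, ∀ n < N w h, ¬ hasLocalDeadlock (Afam w h) (Bfam w h) conjSat n) ∧
      -- N grows proportionally to w · h
      (∀ w h, w * h ≤ c₂ * N w h) ∧
      (∀ w h, N w h ≤ c₂ * (w * h) + c₂) ∧
      -- and is Ω(|B|²) along the diagonal
      (∀ w, (size w w) ^ 2 ≤ c₂ * N w w + c₂) := by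
  classical
  choose N₀ hN₀ hd₀ using exists_hasLocalDeadlock
  have hex : ∀ w h, ∃ n, hasLocalDeadlock (tmplA w h) (tmplB w h) conjSat n :=
    fun w h => ⟨_, hd₀ w h⟩
  have hN : ∀ w h, hasLocalDeadlock (tmplA w h) (tmplB w h) conjSat (Nat.find (hex w h)) :=
    fun w h => Nat.find_spec (hex w h)
  have hmul : ∀ w h, w * h ≤ Nat.find (hex w h) := fun w h => mul_le_of_hasLocalDeadlock (hN w h)
  refine ⟨fun w h => 2 * h + 2 * w + 3, Unit, Unit, Unit, tmplA, tmplB,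
    fun w h => Nat.find (hex w h), 3, 49, fun w => w + 3, by norm_num, by norm_num,
    conjInitAssumption_tmpl, fun w h => by dsimp only; omega, fun w h => by dsimp only; omega,
    ncard_ntGuards_tmpl_le, fun w h => ?_, hN, fun w h n hn => Nat.find_min (hex w h) hn,
    fun w h => ?_, fun w h => ?_, fun w => ?_⟩
  · refine Nat.pos_of_ne_zero fun h0 => not_hasLocalDeadlock_zero w h ?_
    exact h0 ▸ hN w h
  · exact (hmul w h).trans (by dsimp only; omega)
  · have h1 : Nat.find (hex w h) ≤ N₀ w h := Nat.find_min' _ (hd₀ w h)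
    have h2 := hN₀ w h
    dsimp only
    omega
  · have := hmul w w
    dsimp only
    nlinarith [sq_nonneg ((w : ℤ) - 1), two_mul_le_add_sq w 1]
end GP
end
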